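/- There exist a constant c > 0 and a family of constant-indegree DAGs {G_n} such that G_n has at most c·2^n nodes and, for every s with 1 ≤ s ≤ log n, G_n is (s·2^n/(2n), 2^n/(Σ_{j=0}^{s} binom(n,j)))-depth-robust. -/

import Mathlib

/-! ## Basic digraph notions -/

/-- A directed path in a digraph `Adj`: a nonempty list of vertices, each
consecutive pair joined by a directed edge.  Its length (number of edges)
is `p.length - 1`, so a path "of length d" is a list with `p.length = d + 1`. -/
def PathIn {V : Type*} (Adj : V → V → Prop) (p : List V) : Prop :=
  p ≠ [] ∧ p.Chain' Adj

/-- A digraph is acyclic (is a DAG) if it has no directed cycle. -/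
def Acyclic {V : Type*} (Adj : V → V → Prop) : Prop :=
  ∀ v, ¬ Relation.TransGen Adj v v

/-- In-degree of a vertex. -/
noncomputable def indeg {V : Type*} (Adj : V → V → Prop) (v : V) : ℕ :=
  Nat.card {u // Adj u v}

/-- Out-degree of a vertex. -/
noncomputable def outdeg {V : Type*} (Adj : V → V → Prop) (v : V) : ℕ :=
  Nat.card {w // Adj v w}

/-- `δ(v) = max(indeg(v), outdeg(v))`. -/
noncomputable def delta {V : Type*} (Adj : V → V → Prop) (v : V) : ℕ :=
  max (indeg Adj v) (outdeg Adj v)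

/-- The number of edges of a digraph. -/
noncomputable def numEdges {V : Type*} (Adj : V → V → Prop) : ℕ :=
  Nat.card {e : V × V // Adj e.1 e.2}

/-- `(e,d)`-depth-robustness: for every set `S` of at most `e` vertices,
the graph minus `S` contains a directed path of length `d` (i.e. `d` edges). -/
def DepthRobust {V : Type*} (Adj : V → V → Prop) (e d : ℕ) : Prop :=
  ∀ S : Finset V, S.card ≤ e →
    ∃ p : List V, PathIn Adj p ∧ (∀ v ∈ p, v ∉ S) ∧ p.length = d + 1

/-- `(e,d)`-edge-depth-robustness: for every set `F` of at most `e` edges,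
the graph minus `F` contains a directed path of length `d`. -/
def EdgeDepthRobust {V : Type*} (Adj : V → V → Prop) (e d : ℕ) : Prop :=
  ∀ F : Finset (V × V), (∀ f ∈ F, Adj f.1 f.2) → F.card ≤ e →
    ∃ p : List V, PathIn (fun u w => Adj u w ∧ (u, w) ∉ F) p ∧ p.length = d + 1

/-- `u` is joined to `v` by a directed path all of whose vertices avoid `S`. -/
def ConnAvoiding {V : Type*} (Adj : V → V → Prop) (S : Finset V) (u v : V) : Prop :=
  ∃ p : List V, PathIn Adj p ∧ (∀ x ∈ p, x ∉ S) ∧ p.head? = some u ∧ p.getLast? = some v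

/-- `u` is joined to `v` by a directed path of length at least `d` avoiding `S`. -/
def ConnAvoidingLen {V : Type*} (Adj : V → V → Prop) (S : Finset V) (d : ℕ) (u v : V) : Prop :=
  ∃ p : List V, PathIn Adj p ∧ (∀ x ∈ p, x ∉ S) ∧ p.head? = some u ∧
    p.getLast? = some v ∧ d + 1 ≤ p.length

/-! ## Digraphs with designated inputs and outputs -/

/-- A finite digraph with `n` designated (distinct) inputs and `n` designated
(distinct) outputs. -/
structure IOGraph (n : ℕ) where
  V : Type
  [fin : Fintype V]
  [dec : DecidableEq V]
  Adj : V → V → Prop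
  inp : Fin n ↪ V
  out : Fin n ↪ V

attribute [instance] IOGraph.fin IOGraph.dec

/-- `(k1,k2)`-ST-robustness: after deleting any set `D` of at most `k1` vertices
there remain at least `k2` inputs and `k2` outputs such that every one of these
inputs is connected to every one of these outputs in `G - D`. -/
def STRobust {n : ℕ} (G : IOGraph n) (k1 k2 : ℕ) : Prop :=
  ∀ D : Finset G.V, D.card ≤ k1 →
    ∃ A B : Finset (Fin n), k2 ≤ A.card ∧ k2 ≤ B.card ∧
      ∀ a ∈ A, ∀ b ∈ B, ConnAvoiding G.Adj D (G.inp a) (G.out b)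

/-- `(k1,k2,d)`-ST-robustness: as `STRobust`, with all the connecting paths of
length at least `d`. -/
def STRobustD {n : ℕ} (G : IOGraph n) (k1 k2 d : ℕ) : Prop :=
  ∀ D : Finset G.V, D.card ≤ k1 →
    ∃ A B : Finset (Fin n), k2 ≤ A.card ∧ k2 ≤ B.card ∧
      ∀ a ∈ A, ∀ b ∈ B, ConnAvoidingLen G.Adj D d (G.inp a) (G.out b)

/-- Maximally ST-robust: `(k, n-k)`-ST-robust for all `0 ≤ k ≤ n`. -/
def MaxSTRobust {n : ℕ} (G : IOGraph n) : Prop := ∀ k ≤ n, STRobust G k (n - k)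

/-- Maximally ST-robust with depth `d`: `(k, n-k, d)`-ST-robust for all `0 ≤ k ≤ n`. -/
def MaxSTRobustD {n : ℕ} (G : IOGraph n) (d : ℕ) : Prop := ∀ k ≤ n, STRobustD G k (n - k) d

/-- An `n`-superconcentrator: for every `1 ≤ r ≤ n` and every `r` inputs and `r`
outputs there are `r` vertex-disjoint directed paths connecting the chosen inputs
to the chosen outputs. -/
def Superconcentrator {n : ℕ} (G : IOGraph n) : Prop :=
  ∀ r, 1 ≤ r → r ≤ n → ∀ X Y : Finset (Fin n), X.card = r → Y.card = r →
    ∃ P : Fin r → List G.V,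
      (∀ i, PathIn G.Adj (P i) ∧ (∃ x ∈ X, (P i).head? = some (G.inp x)) ∧
        ∃ y ∈ Y, (P i).getLast? = some (G.out y)) ∧
      ∀ i j, i ≠ j → ∀ v ∈ P i, v ∉ P j

/-- An `n`-connector: an `n`-superconcentrator such that moreover, for every
`1 ≤ r ≤ n`, every sequence of `r` distinct inputs and every sequence of `r`
distinct outputs, there are `r` vertex-disjoint directed paths where the `i`-th
path goes from the `i`-th chosen input to the `i`-th chosen output. -/
def Connector {n : ℕ} (G : IOGraph n) : Prop :=
  Superconcentrator G ∧
  ∀ r, 1 ≤ r → r ≤ n → ∀ x y : Fin r ↪ Fin n,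
    ∃ P : Fin r → List G.V,
      (∀ i, PathIn G.Adj (P i) ∧ (P i).head? = some (G.inp (x i)) ∧
        (P i).getLast? = some (G.out (y i))) ∧
      ∀ i j, i ≠ j → ∀ v ∈ P i, v ∉ P j

/-- A bundled finite digraph. -/
structure Dig where
  V : Type
  [fin : Fintype V]
  [dec : DecidableEq V]
  Adj : V → V → Prop

attribute [instance] Dig.fin Dig.dec

/-- `(s,t,ε)`-hardness of a graph together with a challenge set `VC`: for every
set `S` of at most `s` vertices, at least a `(1-ε)` fraction of the nodes of `VC`
have depth at least `t` in `G - S` (i.e. are the endpoint of a directed path of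
length `≥ t` in `G - S`). -/
def Hard {T : Type*} (Adj : T → T → Prop) (VC : Finset T) (s t : ℕ) (ε : ℝ) : Prop :=
  ∀ S : Finset T, S.card ≤ s →
    (1 - ε) * (VC.card : ℝ) ≤
      (Set.ncard {v | v ∈ VC ∧ ∃ p : List T, PathIn Adj p ∧ (∀ x ∈ p, x ∉ S) ∧
        p.getLast? = some v ∧ t + 1 ≤ p.length} : ℝ)

namespace Grate
open Finset Classical

noncomputable def blk (k : ℕ) (p : ℤ) : Finset ℤ := Finset.Ico (p * 2 ^ k) ((p + 1) * 2 ^ k)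

lemma mem_blk {k : ℕ} {p x : ℤ} : x ∈ blk k p ↔ x / 2 ^ k = p := by
  have h : (0 : ℤ) < 2 ^ k := by positivity
  rw [blk, Finset.mem_Ico, ← Int.le_ediv_iff_mul_le h, ← Int.ediv_lt_iff_lt_mul h]
  omega

lemma card_blk (k : ℕ) (p : ℤ) : (blk k p).card = 2 ^ k := by
  rw [blk, Int.card_Ico]
  have : (p + 1) * 2 ^ k - p * 2 ^ k = ((2 ^ k : ℕ) : ℤ) := by push_cast; ring
  rw [this, Int.toNat_natCast]

lemma div_succ (x : ℤ) (k : ℕ) : x / 2 ^ (k + 1) = x / 2 ^ k / 2 := by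
  rw [Int.ediv_ediv_of_nonneg (by positivity), pow_succ]

lemma blk_disj {k : ℕ} {p q : ℤ} (h : p ≠ q) : Disjoint (blk k p) (blk k q) := by
  rw [Finset.disjoint_left]
  intro a ha hb
  rw [mem_blk] at ha hb
  exact h (ha ▸ hb)

noncomputable def reg (k : ℕ) (x : ℤ) : Finset ℤ := blk k (x / 2 ^ k) ∪ blk k (x / 2 ^ k + 1)

lemma mem_reg {k : ℕ} {x y : ℤ} : y ∈ reg k x ↔ y / 2 ^ k = x / 2 ^ k ∨ y / 2 ^ k = x / 2 ^ k + 1 := by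
  simp [reg, mem_blk]

noncomputable def W (f : ℤ → ℤ) (k : ℕ) (x : ℤ) : ℕ := ((reg k x).filter (fun y => f x ≤ f y)).card

lemma W_pos (f : ℤ → ℤ) (k : ℕ) (x : ℤ) : 1 ≤ W f k x := by
  apply Finset.card_pos.mpr
  exact ⟨x, by simp [mem_reg]⟩

lemma W_le (f : ℤ → ℤ) (k : ℕ) (x : ℤ) : W f k x ≤ 2 * 2 ^ k := by
  unfold W
  refine (card_filter_le _ _).trans ?_
  unfold reg
  refine (card_union_le _ _).trans ?_
  rw [card_blk, card_blk]; omega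

lemma reg_mono (k : ℕ) (x : ℤ) : reg k x ⊆ reg (k + 1) x := by
  intro y hy
  rw [mem_reg] at *
  rw [div_succ, div_succ]
  omega

lemma W_mono (f : ℤ → ℤ) (k : ℕ) (x : ℤ) : W f k x ≤ W f (k + 1) x :=
  card_le_card (filter_subset_filter _ (reg_mono k x))

noncomputable def ell (S : Finset ℤ) (k : ℕ) (q : ℤ) : ℕ :=
  (S.filter (fun y => q ≤ y / 2 ^ k ∧ y / 2 ^ k ≤ q + 2)).card

lemma fiber_le (f : ℤ → ℤ) (k : ℕ) (S X : Finset ℤ) (q : ℤ) :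
    (X.filter (fun x => x / 2 ^ k = q ∧ W f k x ≤ 16 * ell S k q)).card ≤ 16 * ell S k q := by
  set A := X.filter (fun x => x / 2 ^ k = q ∧ W f k x ≤ 16 * ell S k q) with hA
  rcases A.eq_empty_or_nonempty with h | h
  · rw [h]; simp
  obtain ⟨x0, hx0, hmin⟩ := Finset.exists_min_image A f h
  have h0 := (mem_filter.mp hx0).2
  refine le_trans ?_ h0.2
  apply card_le_card
  intro y hy
  have h1 := (mem_filter.mp hy).2
  rw [mem_filter, mem_reg]
  exact ⟨Or.inl (h1.1.trans h0.1.symm), hmin y hy⟩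

lemma sum_ell (S : Finset ℤ) (k : ℕ) (Q : Finset ℤ) : ∑ q ∈ Q, ell S k q ≤ 3 * S.card := by
  unfold ell
  simp_rw [card_filter]
  rw [sum_comm]
  have : ∀ y ∈ S, ∑ q ∈ Q, (if q ≤ y / 2 ^ k ∧ y / 2 ^ k ≤ q + 2 then 1 else 0) ≤ 3 := by
    intro y _
    rw [← card_filter]
    refine le_trans (card_le_card (t := Finset.Icc (y / 2 ^ k - 2) (y / 2 ^ k)) ?_) ?_
    · intro q hq
      have := (mem_filter.mp hq).2
      rw [mem_Icc]; omega
    · rw [Int.card_Icc]; omega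
  refine (sum_le_sum this).trans ?_
  simp [mul_comm]

lemma F_count (f : ℤ → ℤ) (k : ℕ) (S X : Finset ℤ) :
    (X.filter (fun x => W f k x ≤ 16 * ell S k (x / 2 ^ k))).card ≤ 48 * S.card := by
  set A := X.filter (fun x => W f k x ≤ 16 * ell S k (x / 2 ^ k)) with hA
  rw [card_eq_sum_card_fiberwise (f := fun x => x / 2 ^ k) (t := A.image (fun x => x / 2 ^ k))
    (fun x hx => mem_image_of_mem _ hx)]
  have : ∀ q ∈ A.image (fun x => x / 2 ^ k), (A.filter (fun x => x / 2 ^ k = q)).card ≤ 16 * ell S k q := by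
    intro q _
    refine le_trans (card_le_card ?_) (fiber_le f k S X q)
    intro x hx
    simp only [hA, mem_filter] at hx ⊢
    refine ⟨hx.1.1, hx.2, ?_⟩
    rw [← hx.2]; exact hx.1.2
  refine (sum_le_sum this).trans ?_
  rw [← mul_sum]
  have := sum_ell S k (A.image (fun x => x / 2 ^ k))
  omega

/-- forward expansion -/
noncomputable def ExpF (E : ℤ → ℤ → Prop) (k : ℕ) : Prop :=
  ∀ p, ∀ Z ⊆ blk k p, min (256 * Z.card) (14 * 2 ^ k) ≤
    16 * ((blk k (p + 1)).filter (fun y => ∃ z ∈ Z, E z y)).card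

noncomputable def badIn (S : Finset ℤ) (k : ℕ) (p : ℤ) : ℕ := (S.filter (fun y => y / 2 ^ k = p)).card

/-- one step: from a set of points above level `v`, in block p, to block p+1 -/
lemma step (E : ℤ → ℤ → Prop) (k : ℕ) (hE : ExpF E k) (f : ℤ → ℤ) (B : Finset ℤ)
    (hm : ∀ x y, x ∉ B → y ∉ B → E x y → f x < f y) (p v : ℤ) (Z : Finset ℤ)
    (hZ : Z ⊆ blk k p) (hv : ∀ z ∈ Z, v ≤ f z) :
    min (256 * (Z.card - badIn B k p)) (14 * 2 ^ k) ≤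
      16 * (((blk k (p + 1)).filter (fun y => v < f y)).card + badIn B k (p + 1)) := by
  have h1 := hE p (Z \ B) (sdiff_subset.trans hZ)
  have h2 : Z.card - badIn B k p ≤ (Z \ B).card := by
    have : Z.card ≤ (Z \ B).card + badIn B k p := by
      rw [← card_sdiff_add_card_inter Z B]
      gcongr
      apply card_le_card
      intro y hy
      rw [mem_inter] at hy
      rw [mem_filter]
      exact ⟨hy.2, mem_blk.mp (hZ hy.1)⟩
    omega
  have h3 : ((blk k (p + 1)).filter (fun y => ∃ z ∈ Z \ B, E z y)).card ≤
      ((blk k (p + 1)).filter (fun y => v < f y)).card + badIn B k (p + 1) := by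
    unfold badIn
    refine le_trans (card_le_card ?_) (card_union_le _ _)
    intro y hy
    rw [mem_filter] at hy
    obtain ⟨hy1, z, hz, hzy⟩ := hy
    rw [mem_sdiff] at hz
    rw [mem_union, mem_filter, mem_filter]
    by_cases hb : y ∈ B
    · right; exact ⟨hb, mem_blk.mp hy1⟩
    · left; exact ⟨hy1, (hv z hz.1).trans_lt (hm z y hz.2 hb hzy)⟩
  refine le_trans ?_ (h1.trans (Nat.mul_le_mul_left 16 h3))
  exact min_le_min (Nat.mul_le_mul_left _ h2) le_rfl

lemma W_split (f : ℤ → ℤ) (k : ℕ) (x : ℤ) : ∃ p, (p = x / 2 ^ k ∨ p = x / 2 ^ k + 1) ∧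
    W f k x ≤ 2 * ((blk k p).filter (fun y => f x ≤ f y)).card := by
  have : W f k x ≤ ((blk k (x / 2 ^ k)).filter (fun y => f x ≤ f y)).card +
      ((blk k (x / 2 ^ k + 1)).filter (fun y => f x ≤ f y)).card := by
    unfold W reg
    rw [filter_union]
    exact card_union_le _ _
  by_cases h : ((blk k (x / 2 ^ k)).filter (fun y => f x ≤ f y)).card ≤
      ((blk k (x / 2 ^ k + 1)).filter (fun y => f x ≤ f y)).card
  · exact ⟨_, Or.inr rfl, by omega⟩
  · exact ⟨_, Or.inl rfl, by omega⟩

lemma bad_union (D S : Finset ℤ) (k : ℕ) (p : ℤ) : badIn (D ∪ S) k p ≤ badIn D k p + badIn S k p := by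
  unfold badIn
  rw [filter_union]
  exact card_union_le _ _

lemma bad_two_le_ell (S : Finset ℤ) (k : ℕ) (q p : ℤ) (h : p = q ∨ p = q + 1) :
    badIn S k p + badIn S k (p + 1) ≤ ell S k q := by
  unfold badIn ell
  rw [← card_union_of_disjoint]
  · apply card_le_card
    intro y
    simp only [mem_union, mem_filter]
    rintro (⟨a, b⟩ | ⟨a, b⟩) <;> refine ⟨a, ?_⟩ <;> omega
  · rw [disjoint_left]
    intro y hy hz
    rw [mem_filter] at hy hz
    omega

lemma transition (E : ℤ → ℤ → Prop) (k : ℕ) (hE : ExpF E k) (f : ℤ → ℤ) (D S : Finset ℤ)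
    (hm : ∀ x y, x ∉ D ∪ S → y ∉ D ∪ S → E x y → f x < f y) (x : ℤ)
    (hF : ¬ W f k x ≤ 16 * ell S k (x / 2 ^ k))
    (hD : ∀ p, x / 2 ^ k ≤ p → p ≤ x / 2 ^ k + 2 → 32 * badIn D k p ≤ W f k x) :
    4 * W f k x ≤ W f (k + 1) x ∨ 2 ^ (k + 1) ≤ 4 * W f (k + 1) x := by
  obtain ⟨p, hp, hw⟩ := W_split f k x
  have h1 := step E k hE f _ hm p (f x) _ (filter_subset (fun y => f x ≤ f y) (blk k p))
    (fun z hz => (mem_filter.mp hz).2)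
  have h2 := bad_two_le_ell S k _ p hp
  have h3 := hD p (by omega) (by omega)
  have h4 := hD (p + 1) (by omega) (by omega)
  have h5 := bad_union D S k p
  have h6 := bad_union D S k (p + 1)
  have h7 : ((blk k (p + 1)).filter (fun y => f x < f y)).card ≤ W f (k + 1) x := by
    apply card_le_card
    intro y
    rw [mem_filter, mem_filter, mem_blk, mem_reg, div_succ, div_succ]
    rintro ⟨a, b⟩
    refine ⟨?_, b.le⟩
    omega
  have h8 := W_le f k x
  rw [pow_succ]
  generalize 2 ^ k = N at *
  omega

lemma chain (E : ℤ → ℤ → Prop) (k : ℕ) (hE : ExpF E k) (f : ℤ → ℤ) (D S : Finset ℤ)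
    (hm : ∀ x y, x ∉ D ∪ S → y ∉ D ∪ S → E x y → f x < f y) (x : ℤ)
    (hw : 2 ^ k ≤ 4 * W f k x)
    (hD : ∀ p, x / 2 ^ k ≤ p → p ≤ x / 2 ^ k + 6 → 32 * badIn D k p ≤ 2 ^ k)
    (hS : ∀ p, x / 2 ^ k ≤ p → p ≤ x / 2 ^ k + 6 → 32 * badIn S k p ≤ 2 ^ k)
    (p : ℤ) (hp : x / 2 ^ k + 2 ≤ p) (hp' : p ≤ x / 2 ^ k + 6) :
    3 * 2 ^ k ≤ 4 * ((blk k p).filter (fun y => f x < f y)).card := by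
  obtain ⟨p0, hp0, hw0⟩ := W_split f k x
  have key : ∀ i : ℕ, p0 + 1 + i ≤ x / 2 ^ k + 6 →
      3 * 2 ^ k ≤ 4 * ((blk k (p0 + 1 + i)).filter (fun y => f x < f y)).card := by
    intro i
    induction i with
    | zero =>
      intro hi
      have h1 := step E k hE f _ hm p0 (f x) _ (filter_subset (fun y => f x ≤ f y) (blk k p0))
        (fun z hz => (mem_filter.mp hz).2)
      have h5 := bad_union D S k p0
      have h6 := bad_union D S k (p0 + 1)
      have := hD p0 (by omega) (by omega)
      have := hD (p0 + 1) (by omega) (by omega)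
      have := hS p0 (by omega) (by omega)
      have := hS (p0 + 1) (by omega) (by omega)
      simp only [Nat.cast_zero, add_zero]
      generalize 2 ^ k = N at *
      omega
    | succ i ih =>
      intro hi
      push_cast at hi
      have ih := ih (by omega)
      have h1 := step E k hE f _ hm (p0 + 1 + i) (f x) _
        (filter_subset (fun y => f x < f y) (blk k (p0 + 1 + i)))
        (fun z hz => (mem_filter.mp hz).2.le)
      have h5 := bad_union D S k (p0 + 1 + i)
      have h6 := bad_union D S k (p0 + 1 + i + 1)
      have := hD (p0 + 1 + i) (by omega) (by omega)
      have := hD (p0 + 1 + i + 1) (by omega) (by omega)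
      have := hS (p0 + 1 + i) (by omega) (by omega)
      have := hS (p0 + 1 + i + 1) (by omega) (by omega)
      have e : p0 + 1 + ((i + 1 : ℕ) : ℤ) = p0 + 1 + i + 1 := by push_cast; ring
      rw [e]
      generalize 2 ^ k = N at *
      omega
  have := key (p - (p0 + 1)).toNat
  have e : p0 + 1 + ((p - (p0 + 1)).toNat : ℤ) = p := by omega
  rw [e] at this
  exact this hp'

/-- dead-good points -/
noncomputable def DG (D : Finset ℤ) (L r : ℕ) (x : ℤ) : Prop :=
  ∀ k < L, ∀ p, x / 2 ^ k - 6 ≤ p → p ≤ x / 2 ^ k + 6 → 2 ^ (r + 8) * badIn D k p ≤ 2 ^ k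

lemma walk (E : ℕ → ℤ → ℤ → Prop) (L r : ℕ) (hE : ∀ k < L, ExpF (E k) k) (f : ℤ → ℤ)
    (D : Finset ℤ) (S : ℕ → Finset ℤ)
    (hm : ∀ k < L, ∀ x y, x ∉ D ∪ S k → y ∉ D ∪ S k → E k x y → f x < f y) (x : ℤ)
    (hx : DG D L r x)
    (hF : ((range L).filter (fun k => W f k x ≤ 16 * ell (S k) k (x / 2 ^ k))).card ≤ r) :
    ((range L).filter (fun k => 4 * W f k x < 2 ^ k)).card ≤
      2 * ((range L).filter (fun k => W f k x ≤ 16 * ell (S k) k (x / 2 ^ k))).card := by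
  have key : ∀ K ≤ L, ∃ a, a ≤ ((range K).filter (fun k => W f k x ≤ 16 * ell (S k) k (x / 2 ^ k))).card ∧
      2 ^ K ≤ 2 ^ (a + 2) * W f K x ∧
      ((range K).filter (fun k => 4 * W f k x < 2 ^ k)).card + a ≤
      2 * ((range K).filter (fun k => W f k x ≤ 16 * ell (S k) k (x / 2 ^ k))).card := by
    intro K
    induction K with
    | zero =>
      intro _
      refine ⟨0, by simp, ?_, by simp⟩
      have := W_pos f 0 x
      simp; omega
    | succ K ih =>
      intro hK
      obtain ⟨a, ha, hw, hc⟩ := ih (by omega)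
      have hsub : ((range K).filter (fun k => W f k x ≤ 16 * ell (S k) k (x / 2 ^ k))).card ≤ r := by
        refine le_trans (card_le_card ?_) hF
        apply filter_subset_filter
        intro i; simp; omega
      have hmono := W_mono f K x
      rw [range_add_one, filter_insert, filter_insert]
      by_cases hfail : W f K x ≤ 16 * ell (S K) K (x / 2 ^ K)
      · rw [if_pos hfail, card_insert_of_notMem (by simp)]
        refine ⟨a + 1, by omega, ?_, ?_⟩
        · rw [pow_succ, show a + 1 + 2 = (a + 2) + 1 from rfl, pow_succ]
          nlinarith [Nat.zero_le (2 ^ (a + 2))]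
        · split_ifs
          · rw [card_insert_of_notMem (by simp)]; omega
          · omega
      · rw [if_neg hfail]
        have hd : ∀ p, x / 2 ^ K ≤ p → p ≤ x / 2 ^ K + 2 → 32 * badIn D K p ≤ W f K x := by
          intro p hp hp'
          have h1 := hx K (by omega) p (by omega) (by omega)
          have h2 : 2 ^ (a + 2) ≤ 2 ^ (r + 2) := Nat.pow_le_pow_right (by norm_num) (by omega)
          have h3 : 2 ^ (r + 2) * (64 * badIn D K p) ≤ 2 ^ (r + 2) * W f K x := by
            calc 2 ^ (r + 2) * (64 * badIn D K p) = 2 ^ (r + 8) * badIn D K p := by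
                  rw [pow_add, pow_add]; ring
              _ ≤ 2 ^ K := h1
              _ ≤ _ := hw
              _ ≤ _ := Nat.mul_le_mul_right _ h2
          have := Nat.le_of_mul_le_mul_left h3 (by positivity)
          omega
        have ht := transition (E K) K (hE K (by omega)) f D (S K) (hm K (by omega)) x hfail hd
        rcases Nat.eq_zero_or_pos a with h0 | h0
        · subst h0
          refine ⟨0, by omega, ?_, ?_⟩
          · rw [pow_succ] at *
            norm_num at *
            omega
          · rw [if_neg (by norm_num at hw; omega)]
            exact hc
        · obtain ⟨b, rfl⟩ : ∃ b, a = b + 1 := ⟨a - 1, by omega⟩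
          refine ⟨b, by omega, ?_, ?_⟩
          · rcases ht with ht | ht
            · rw [pow_succ]
              rw [show b + 1 + 2 = (b + 2) + 1 from rfl, pow_succ] at hw
              nlinarith [Nat.zero_le (2 ^ (b + 2))]
            · refine ht.trans ?_
              apply Nat.mul_le_mul_right
              rw [pow_add]
              have : 1 ≤ 2 ^ b := Nat.one_le_two_pow
              omega
          · split_ifs
            · rw [card_insert_of_notMem (by simp)]; omega
            · omega
  obtain ⟨a, _, _, h⟩ := key L le_rfl
  omega

end Grate

namespace Grate
open Finset Classical

def Hv (c : ℕ) (D : Finset ℤ) (k : ℕ) (x : ℤ) : Prop :=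
  ∃ p, x / 2 ^ k - 6 ≤ p ∧ p ≤ x / 2 ^ k + 6 ∧ 2 ^ k < c * badIn D k p

lemma sum_badIn (D : Finset ℤ) (k : ℕ) (P : Finset ℤ) : ∑ p ∈ P, badIn D k p ≤ D.card := by
  unfold badIn
  rw [← card_biUnion]
  · apply card_le_card
    intro y; simp only [mem_biUnion, mem_filter]; rintro ⟨_, _, h, _⟩; exact h
  · intro p _ q _ h
    rw [Function.onFun, disjoint_left]
    intro y hy hz
    exact h ((mem_filter.mp hy).2.symm.trans (mem_filter.mp hz).2)

lemma heavy_count (c : ℕ) (D : Finset ℤ) (k : ℕ) (X : Finset ℤ) :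
    (X.filter (Hv c D k)).card ≤ 13 * c * D.card := by
  set P := (D.image (fun y => y / 2 ^ k)).filter (fun p => 2 ^ k < c * badIn D k p) with hP
  have h1 : X.filter (Hv c D k) ⊆ P.biUnion (fun p => (Finset.Icc (-6 : ℤ) 6).biUnion (fun j => blk k (p + j))) := by
    intro x hx
    obtain ⟨hx, p, h1, h2, h3⟩ := mem_filter.mp hx
    rw [mem_biUnion]
    refine ⟨p, ?_, ?_⟩
    · rw [hP, mem_filter]
      refine ⟨?_, h3⟩
      have : 0 < badIn D k p := by
        rcases Nat.eq_zero_or_pos (badIn D k p) with h | h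
        · rw [h, mul_zero] at h3; exact absurd h3 (Nat.not_lt_zero _)
        · exact h
      obtain ⟨y, hy⟩ := card_pos.mp this
      rw [mem_image]
      exact ⟨y, (mem_filter.mp hy).1, (mem_filter.mp hy).2⟩
    · rw [mem_biUnion]
      refine ⟨x / 2 ^ k - p, ?_, ?_⟩
      · rw [mem_Icc]; omega
      · rw [mem_blk]; ring
  refine (card_le_card h1).trans ?_
  have h2 : (P.biUnion (fun p => (Finset.Icc (-6 : ℤ) 6).biUnion (fun j => blk k (p + j)))).card ≤ P.card * (13 * 2 ^ k) := by
    apply card_biUnion_le_card_mul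
    intro p _
    have := card_biUnion_le_card_mul (Finset.Icc (-6 : ℤ) 6) (fun j => blk k (p + j)) (2 ^ k)
      (fun j _ => (card_blk _ _).le)
    simpa using this
  have h3 : P.card * 2 ^ k ≤ c * D.card := by
    calc P.card * 2 ^ k = ∑ p ∈ P, 2 ^ k := by simp
      _ ≤ ∑ p ∈ P, c * badIn D k p := sum_le_sum (fun p hp => (mem_filter.mp hp).2.le)
      _ = c * ∑ p ∈ P, badIn D k p := by rw [mul_sum]
      _ ≤ _ := Nat.mul_le_mul_left _ (sum_badIn D k P)
  nlinarith

lemma near_mono (x y : ℤ) (k m : ℕ) (h : k ≤ m) (h1 : x / 2 ^ k - 6 ≤ y / 2 ^ k)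
    (h2 : y / 2 ^ k ≤ x / 2 ^ k + 6) : x / 2 ^ m - 6 ≤ y / 2 ^ m ∧ y / 2 ^ m ≤ x / 2 ^ m + 6 := by
  induction m, h using Nat.le_induction with
  | base => exact ⟨h1, h2⟩
  | succ m _ ih => rw [div_succ, div_succ]; omega

lemma maximal (c : ℕ) (K : ℕ) (X : Finset ℤ) : ∀ D : Finset ℤ,
    (X.filter (fun x => ∃ k < K, Hv c D k x)).card ≤ 13 * c * D.card := by
  induction K with
  | zero => intro D; simp
  | succ K ih =>
    intro D
    set D1 := D.filter (fun y => 2 ^ K < c * badIn D K (y / 2 ^ K)) with hD1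
    set D2 := D.filter (fun y => ¬ 2 ^ K < c * badIn D K (y / 2 ^ K)) with hD2
    have hsum : D1.card + D2.card = D.card := card_filter_add_card_filter_not _
    have hsub : X.filter (fun x => ∃ k < K + 1, Hv c D k x) ⊆
        X.filter (Hv c D1 K) ∪ X.filter (fun x => ∃ k < K, Hv c D2 k x) := by
      intro x hx
      obtain ⟨hx, k, hk, p, h1, h2, h3⟩ := mem_filter.mp hx
      have top : ∀ p, x / 2 ^ K - 6 ≤ p → p ≤ x / 2 ^ K + 6 → 2 ^ K < c * badIn D K p →
          x ∈ X.filter (Hv c D1 K) := by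
        intro p h1 h2 h3
        refine mem_filter.mpr ⟨hx, p, h1, h2, lt_of_lt_of_le h3 ?_⟩
        apply Nat.mul_le_mul_left
        apply card_le_card
        intro y hy
        rw [mem_filter] at hy
        rw [mem_filter, hD1, mem_filter, hy.2]
        exact ⟨⟨hy.1, h3⟩, rfl⟩
      rw [mem_union]
      by_cases hkK : k = K
      · subst hkK; left; exact top p h1 h2 h3
      by_cases hy : ∃ y ∈ D1, y / 2 ^ k = p
      · obtain ⟨y, hy, rfl⟩ := hy
        left
        have := near_mono x y k K (by omega) h1 h2
        exact top _ this.1 this.2 (mem_filter.mp hy).2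
      · right
        refine mem_filter.mpr ⟨hx, k, by omega, p, h1, h2, lt_of_lt_of_le h3 ?_⟩
        apply Nat.mul_le_mul_left
        apply card_le_card
        intro y hyy
        rw [mem_filter] at hyy
        rw [mem_filter, hD2, mem_filter]
        refine ⟨⟨hyy.1, fun h => hy ⟨y, ?_, hyy.2⟩⟩, hyy.2⟩
        rw [hD1, mem_filter]; exact ⟨hyy.1, h⟩
    refine (card_le_card hsub).trans ((card_union_le _ _).trans ?_)
    have := heavy_count c D1 K X
    have := ih D2
    rw [← hsum, mul_add]; omega

lemma DG_count (D : Finset ℤ) (L r : ℕ) (X : Finset ℤ) :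
    (X.filter (fun x => ¬ DG D L r x)).card ≤ 13 * 2 ^ (r + 8) * D.card := by
  refine le_trans (card_le_card ?_) (maximal (2 ^ (r + 8)) L X D)
  intro x hx
  rw [mem_filter] at *
  refine ⟨hx.1, ?_⟩
  have := hx.2
  unfold DG at this
  push Not at this
  obtain ⟨k, hk, p, h1, h2, h3⟩ := this
  exact ⟨k, hk, p, h1, h2, h3⟩

/-! reversal -/
def rv (x : ℤ) : ℤ := -1 - x

lemma rv_rv (x : ℤ) : rv (rv x) = x := by unfold rv; ring

lemma rv_inj : Function.Injective rv := fun x y h => by unfold rv at h; omega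

lemma rv_div (x : ℤ) (k : ℕ) : rv x / 2 ^ k = rv (x / 2 ^ k) := by
  have h : (0 : ℤ) < 2 ^ k := by positivity
  have h1 := Int.emod_add_mul_ediv x (2 ^ k)
  have h2 := Int.emod_nonneg x h.ne'
  have h3 := Int.emod_lt_of_pos x h
  unfold rv
  rw [← mem_blk, blk, mem_Ico]
  constructor <;> nlinarith

def rvf (f : ℤ → ℤ) (x : ℤ) : ℤ := - f (rv x)
noncomputable def rvs (S : Finset ℤ) : Finset ℤ := S.image rv

lemma mem_rvs {S : Finset ℤ} {x : ℤ} : x ∈ rvs S ↔ rv x ∈ S := by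
  unfold rvs
  rw [mem_image]
  constructor
  · rintro ⟨y, hy, rfl⟩; rwa [rv_rv]
  · intro h; exact ⟨_, h, rv_rv x⟩

lemma card_rvs (S : Finset ℤ) : (rvs S).card = S.card := card_image_of_injective _ rv_inj

lemma rvs_rvs (S : Finset ℤ) : rvs (rvs S) = S := by
  ext x; rw [mem_rvs, mem_rvs, rv_rv]

lemma badIn_rvs (S : Finset ℤ) (k : ℕ) (p : ℤ) : badIn (rvs S) k p = badIn S k (rv p) := by
  unfold badIn
  rw [← card_rvs (filter _ S)]
  congr 1
  ext x
  rw [mem_filter, mem_rvs, mem_rvs, mem_filter, rv_div]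
  rw [rv_inj.eq_iff]

lemma blk_rvs (k : ℕ) (p : ℤ) : rvs (blk k p) = blk k (rv p) := by
  ext x
  rw [mem_rvs, mem_blk, mem_blk, rv_div]
  constructor
  · intro h; rw [← h, rv_rv]
  · intro h; rw [h, rv_rv]

lemma DG_rv {D : Finset ℤ} {L r : ℕ} {x : ℤ} (h : DG D L r x) : DG (rvs D) L r (rv x) := by
  intro k hk p h1 h2
  rw [badIn_rvs]
  rw [rv_div] at h1 h2
  apply h k hk <;> unfold rv at * <;> omega

/-- all the data -/
structure Sys (L : ℕ) (E : ℕ → ℤ → ℤ → Prop) (f : ℤ → ℤ) (D : Finset ℤ) (S : ℕ → Finset ℤ) : Prop where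
  ef : ∀ k < L, ExpF (E k) k
  eb : ∀ k < L, ExpF (fun x y => E k (rv y) (rv x)) k
  mono : ∀ k < L, ∀ x y, x ∉ D ∪ S k → y ∉ D ∪ S k → E k x y → f x < f y

lemma Sys.rev {L : ℕ} {E : ℕ → ℤ → ℤ → Prop} {f : ℤ → ℤ} {D : Finset ℤ} {S : ℕ → Finset ℤ}
    (h : Sys L E f D S) :
    Sys L (fun k x y => E k (rv y) (rv x)) (rvf f) (rvs D) (fun k => rvs (S k)) where
  ef := h.eb
  eb := by simpa only [rv_rv] using h.ef
  mono := by
    intro k hk x y hx hy he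
    have : ∀ z, z ∉ rvs D ∪ rvs (S k) → rv z ∉ D ∪ S k := by
      intro z; simp only [mem_union, mem_rvs, imp_self]
    have := h.mono k hk _ _ (this _ hy) (this _ hx) he
    unfold rvf; omega

def Fu (f : ℤ → ℤ) (S : ℕ → Finset ℤ) (k : ℕ) (x : ℤ) : Prop := W f k x ≤ 16 * ell (S k) k (x / 2 ^ k)
def Fd (f : ℤ → ℤ) (S : ℕ → Finset ℤ) (k : ℕ) (x : ℤ) : Prop := Fu (rvf f) (fun k => rvs (S k)) k (rv x)

lemma Fu_count (f : ℤ → ℤ) (S : ℕ → Finset ℤ) (k : ℕ) (X : Finset ℤ) :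
    (X.filter (Fu f S k)).card ≤ 48 * (S k).card := by
  refine le_trans (le_of_eq ?_) (F_count f k (S k) X)
  congr 1
  ext x
  rw [mem_filter, mem_filter]; rfl

lemma Fu_filter (f : ℤ → ℤ) (S : ℕ → Finset ℤ) (L : ℕ) (x : ℤ) :
    (range L).filter (fun k => Fu f S k x) =
      (range L).filter (fun k => W f k x ≤ 16 * ell (S k) k (x / 2 ^ k)) := by
  ext k
  rw [mem_filter, mem_filter]; rfl

lemma Fd_filter (f : ℤ → ℤ) (S : ℕ → Finset ℤ) (L : ℕ) (x : ℤ) :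
    (range L).filter (fun k => Fd f S k x) =
      (range L).filter (fun k => W (rvf f) k (rv x) ≤ 16 * ell (rvs (S k)) k (rv x / 2 ^ k)) := by
  ext k
  rw [mem_filter, mem_filter]; rfl

lemma Fd_count (f : ℤ → ℤ) (S : ℕ → Finset ℤ) (k : ℕ) (X : Finset ℤ) :
    (X.filter (Fd f S k)).card ≤ 48 * (S k).card := by
  have := Fu_count (rvf f) (fun k => rvs (S k)) k (rvs X)
  rw [card_rvs] at this
  refine le_trans (le_of_eq ?_) this
  rw [← card_rvs]
  congr 1
  ext x
  rw [mem_rvs, mem_filter, mem_filter, mem_rvs]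
  unfold Fd
  rw [rv_rv]

noncomputable def cost (f : ℤ → ℤ) (S : ℕ → Finset ℤ) (L : ℕ) (x : ℤ) : ℕ :=
  ((range L).filter (fun k => Fu f S k x)).card + ((range L).filter (fun k => Fd f S k x)).card
  + ((range L).filter (fun k => Hv 32 (S k) k x)).card

lemma dbl (L : ℕ) (X : Finset ℤ) (P : ℕ → ℤ → Prop) :
    ∑ x ∈ X, ((range L).filter (fun k => P k x)).card = ∑ k ∈ range L, (X.filter (P k)).card := by
  simp_rw [card_filter]
  rw [sum_comm]

lemma cost_sum (f : ℤ → ℤ) (S : ℕ → Finset ℤ) (L : ℕ) (X : Finset ℤ) :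
    ∑ x ∈ X, cost f S L x ≤ 512 * ∑ k ∈ range L, (S k).card := by
  unfold cost
  rw [sum_add_distrib, sum_add_distrib, dbl, dbl, dbl, ← sum_add_distrib, ← sum_add_distrib, mul_sum]
  apply sum_le_sum
  intro k _
  have := Fu_count f S k X
  have := Fd_count f S k X
  have := heavy_count 32 (S k) k X
  omega

noncomputable def Os (f : ℤ → ℤ) (S : ℕ → Finset ℤ) (L : ℕ) (x : ℤ) : Finset ℕ :=
  (range L).filter (fun k => 4 * W f k x < 2 ^ k ∨ 4 * W (rvf f) k (rv x) < 2 ^ k ∨ Hv 32 (S k) k x)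

section main
variable {L : ℕ} {E : ℕ → ℤ → ℤ → Prop} {f : ℤ → ℤ} {D : Finset ℤ} {S : ℕ → Finset ℤ}

lemma Os_card (h : Sys L E f D S) (r : ℕ) (x : ℤ) (hx : DG D L r x) (hc : cost f S L x ≤ r) :
    (Os f S L x).card ≤ 2 * r := by
  unfold cost at hc
  rw [Fu_filter, Fd_filter] at hc
  have h1 := walk E L r h.ef f D S h.mono x hx (by omega)
  have h2 := walk _ L r h.rev.ef _ _ _ h.rev.mono (rv x) (DG_rv hx) (by omega)
  have h3 : (Os f S L x).card ≤ ((range L).filter (fun k => 4 * W f k x < 2 ^ k)).card +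
     ((range L).filter (fun k => 4 * W (rvf f) k (rv x) < 2 ^ k)).card +
     ((range L).filter (fun k => Hv 32 (S k) k x)).card := by
    unfold Os
    rw [filter_or, filter_or]
    refine (card_union_le _ _).trans ?_
    have := card_union_le ((range L).filter (fun k => 4 * W (rvf f) k (rv x) < 2 ^ k)) ((range L).filter (fun k => Hv 32 (S k) k x))
    omega
  omega

lemma up_chain (h : Sys L E f D S) (r : ℕ) (x : ℤ) (hx : DG D L r x) (k : ℕ) (hk : k < L)
    (ho : k ∉ Os f S L x) (p : ℤ) (hp : x / 2 ^ k + 2 ≤ p) (hp' : p ≤ x / 2 ^ k + 6) :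
    3 * 2 ^ k ≤ 4 * ((blk k p).filter (fun y => f x < f y)).card := by
  unfold Os at ho
  rw [mem_filter, mem_range] at ho
  push Not at ho
  obtain ⟨h1, h2, h3⟩ := ho hk
  refine chain (E k) k (h.ef k hk) f D (S k) (h.mono k hk) x h1 ?_ ?_ p hp hp'
  · intro p hp hp'
    have := hx k hk p (by omega) (by omega)
    refine le_trans (Nat.mul_le_mul_right _ ?_) this
    rw [pow_add]
    have : 1 ≤ 2 ^ r := Nat.one_le_two_pow
    omega
  · intro p hp hp'
    by_contra hcon
    exact h3 ⟨p, by omega, by omega, by omega⟩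

lemma Hv_rv {c : ℕ} {k : ℕ} {x : ℤ} {S : Finset ℤ} (h : Hv c (rvs S) k (rv x)) : Hv c S k x := by
  obtain ⟨p, h1, h2, h3⟩ := h
  rw [badIn_rvs] at h3
  rw [rv_div] at h1 h2
  refine ⟨rv p, ?_, ?_, h3⟩ <;> unfold rv at * <;> omega

lemma Os_rv (k : ℕ) (x : ℤ) (ho : k ∉ Os f S L x) : k ∉ Os (rvf f) (fun k => rvs (S k)) L (rv x) := by
  have hff : rvf (rvf f) = f := by funext y; unfold rvf; rw [rv_rv]; ring
  unfold Os at *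
  rw [mem_filter] at *
  rw [hff, rv_rv]
  intro hh
  apply ho
  refine ⟨hh.1, ?_⟩
  rcases hh.2 with h | h | h
  · right; left; exact h
  · left; exact h
  · right; right; exact Hv_rv h

lemma down_chain (h : Sys L E f D S) (r : ℕ) (x : ℤ) (hx : DG D L r x) (k : ℕ) (hk : k < L)
    (ho : k ∉ Os f S L x) (p : ℤ) (hp : x / 2 ^ k - 6 ≤ p) (hp' : p ≤ x / 2 ^ k - 2) :
    3 * 2 ^ k ≤ 4 * ((blk k p).filter (fun y => f y < f x)).card := by
  have := up_chain h.rev r (rv x) (DG_rv hx) k hk (Os_rv k x ho) (rv p) (by rw [rv_div]; unfold rv; omega)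
    (by rw [rv_div]; unfold rv; omega)
  refine this.trans (le_of_eq ?_)
  congr 1
  rw [← card_rvs]
  congr 1
  ext y
  rw [mem_rvs, mem_filter, mem_filter, mem_blk, mem_blk, rv_div, rv_inj.eq_iff]
  unfold rvf
  rw [rv_rv, rv_rv]
  simp

lemma no_close (h : Sys L E f D S) (r : ℕ) (x x' : ℤ) (hx : DG D L r x) (hx' : DG D L r x') (k : ℕ) (hk : k < L)
    (ho : k ∉ Os f S L x) (ho' : k ∉ Os f S L x') (hf : f x = f x')
    (h1 : x / 2 ^ k + 4 ≤ x' / 2 ^ k) (h2 : x' / 2 ^ k ≤ x / 2 ^ k + 7) : False := by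
  have a := up_chain h r x hx k hk ho (x' / 2 ^ k - 2) (by omega) (by omega)
  have b := down_chain h r x' hx' k hk ho' (x' / 2 ^ k - 2) (by omega) (by omega)
  have c := card_blk k (x' / 2 ^ k - 2)
  have d : ((blk k (x' / 2 ^ k - 2)).filter (fun y => f x < f y)).card + ((blk k (x' / 2 ^ k - 2)).filter (fun y => f y < f x')).card
      ≤ (blk k (x' / 2 ^ k - 2)).card := by
    rw [← card_union_of_disjoint]
    · apply card_le_card
      exact union_subset (filter_subset _ _) (filter_subset _ _)
    · rw [disjoint_left]
      intro y hy hz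
      have := (mem_filter.mp hy).2
      have := (mem_filter.mp hz).2
      omega
  have : 0 < 2 ^ k := by positivity
  omega

lemma class_le (h : Sys L E f D S) (r : ℕ) (C : Finset ℤ) (O : Finset ℕ) (v : ℤ)
    (hC : ∀ x ∈ C, DG D L r x ∧ Os f S L x = O ∧ f x = v) (K : ℕ) (hK : K ≤ L) : ∀ a : ℤ,
    (C.filter (fun x => a ≤ x / 2 ^ K ∧ x / 2 ^ K ≤ a + 3)).card ≤ 4 * 2 ^ ((O.filter (fun k => k < K)).card) := by
  induction K with
  | zero =>
    intro a
    have : C.filter (fun x => a ≤ x / 2 ^ 0 ∧ x / 2 ^ 0 ≤ a + 3) ⊆ Finset.Icc a (a + 3) := by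
      intro x hx
      have := (mem_filter.mp hx).2
      simp only [pow_zero, Int.ediv_one] at this
      rw [mem_Icc]; exact this
    have := card_le_card this
    rw [Int.card_Icc] at this
    simp only [Nat.not_lt_zero, filter_false, card_empty, pow_zero] at *
    omega
  | succ K ih =>
    intro a
    have ih := ih (by omega)
    by_cases hO : K ∈ O
    · have e : (O.filter (fun k => k < K + 1)).card = (O.filter (fun k => k < K)).card + 1 := by
        rw [← card_insert_of_notMem (a := K) (s := O.filter (fun k => k < K)) (by simp)]
        congr 1
        ext k
        simp only [mem_insert, mem_filter]
        constructor
        · rintro ⟨h1, h2⟩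
          by_cases k = K
          · left; assumption
          · right; exact ⟨h1, by omega⟩
        · rintro (rfl | h)
          · exact ⟨hO, by omega⟩
          · exact ⟨h.1, by omega⟩
      rw [e, pow_succ (2 : ℕ) (O.filter (fun k => k < K)).card]
      have i1 := ih (2 * a)
      have i2 := ih (2 * a + 4)
      have : C.filter (fun x => a ≤ x / 2 ^ (K + 1) ∧ x / 2 ^ (K + 1) ≤ a + 3) ⊆
        C.filter (fun x => 2 * a ≤ x / 2 ^ K ∧ x / 2 ^ K ≤ 2 * a + 3) ∪
        C.filter (fun x => 2 * a + 4 ≤ x / 2 ^ K ∧ x / 2 ^ K ≤ 2 * a + 4 + 3) := by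
        intro x
        rw [mem_union, mem_filter, mem_filter, mem_filter, div_succ]
        rintro ⟨hx, h1, h2⟩
        by_cases hh : x / 2 ^ K ≤ 2 * a + 3
        · left; exact ⟨hx, by omega, hh⟩
        · right; exact ⟨hx, by omega, by omega⟩
      have := (card_le_card this).trans (card_union_le _ _)
      omega
    · set A := C.filter (fun x => a ≤ x / 2 ^ (K + 1) ∧ x / 2 ^ (K + 1) ≤ a + 3) with hA
      rcases A.eq_empty_or_nonempty with he | hne
      · rw [he]; simp
      obtain ⟨m, hm, hmin⟩ := exists_min_image A (fun x => x / 2 ^ K) hne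
      refine le_trans (card_le_card ?_) ((ih (m / 2 ^ K)).trans ?_)
      · intro x hx
        have hmx := hmin x hx
        rw [hA, mem_filter, div_succ] at hm hx
        rw [mem_filter]
        refine ⟨hx.1, hmx, ?_⟩
        by_contra hcon
        obtain ⟨d1, o1, f1⟩ := hC m hm.1
        obtain ⟨d2, o2, f2⟩ := hC x hx.1
        exact no_close h r m x d1 d2 K (by omega) (o1 ▸ hO) (o2 ▸ hO) (f1.trans f2.symm) (by omega) (by omega)
      · apply Nat.mul_le_mul_left
        apply Nat.pow_le_pow_right (by norm_num)
        apply card_le_card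
        intro k
        simp only [mem_filter]
        rintro ⟨h1, h2⟩; exact ⟨h1, by omega⟩

lemma patterns (L m : ℕ) : ((range L).powerset.filter (fun O => O.card ≤ m)).card ≤ (L + 1) ^ m := by
  have : (range L).powerset.filter (fun O => O.card ≤ m) ⊆
      (range (m + 1)).biUnion (fun i => (range L).powersetCard i) := by
    intro O hO
    rw [mem_filter, mem_powerset] at hO
    rw [mem_biUnion]
    exact ⟨O.card, by rw [mem_range]; omega, mem_powersetCard.mpr ⟨hO.1, rfl⟩⟩
  refine (card_le_card this).trans (card_biUnion_le.trans ?_)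
  rw [add_pow]
  apply sum_le_sum
  intro i hi
  rw [card_powersetCard, card_range, one_pow, mul_one]
  refine (Nat.choose_le_pow L i).trans ?_
  exact Nat.le_mul_of_pos_right _ (Nat.choose_pos (by rw [mem_range] at hi; omega))

theorem macro_main (h : Sys L E f D S) (r d : ℕ)
    (hf : ∀ x, 0 ≤ x → x < 2 ^ L → x ∉ D → 0 ≤ f x ∧ f x < d)
    (hD : 4 * ((13 * 2 ^ (r + 8) + 1) * D.card) ≤ 2 ^ L)
    (hS : 4096 * ∑ k ∈ range L, (S k).card ≤ (r + 1) * 2 ^ L) :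
    2 ^ L ≤ 8 * d * (2 * (L + 1)) ^ (2 * r) := by
  set X := blk L 0 with hX
  have hXc : X.card = 2 ^ L := card_blk L 0
  set G := X.filter (fun x => x ∉ D ∧ DG D L r x ∧ cost f S L x ≤ r) with hG
  have g1 : (X.filter (fun x => r + 1 ≤ cost f S L x)).card * (r + 1) ≤ 512 * ∑ k ∈ range L, (S k).card := by
    refine le_trans ?_ (cost_sum f S L X)
    calc _ = ∑ x ∈ X.filter (fun x => r + 1 ≤ cost f S L x), (r + 1) := by simp
      _ ≤ ∑ x ∈ X.filter (fun x => r + 1 ≤ cost f S L x), cost f S L x :=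
        sum_le_sum (fun x hx => (mem_filter.mp hx).2)
      _ ≤ _ := sum_le_sum_of_subset (filter_subset _ _)
  have g2 : 8 * (X.filter (fun x => r + 1 ≤ cost f S L x)).card ≤ 2 ^ L := by
    refine Nat.le_of_mul_le_mul_right ?_ (Nat.succ_pos r)
    rw [Nat.succ_eq_add_one]
    nlinarith
  have g3 := DG_count D L r X
  have g4 : X.card ≤ G.card + D.card + (X.filter (fun x => ¬ DG D L r x)).card +
      (X.filter (fun x => r + 1 ≤ cost f S L x)).card := by
    have : X ⊆ G ∪ D ∪ (X.filter (fun x => ¬ DG D L r x)) ∪ (X.filter (fun x => r + 1 ≤ cost f S L x)) := by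
      intro x hx
      simp only [mem_union, hG, mem_filter]
      by_cases a : x ∈ D
      · tauto
      by_cases b : DG D L r x
      · by_cases c : cost f S L x ≤ r
        · tauto
        · right; exact ⟨hx, by omega⟩
      · tauto
    refine (card_le_card this).trans ((card_union_le _ _).trans ?_)
    gcongr
    refine (card_union_le _ _).trans ?_
    gcongr
    exact card_union_le _ _
  have g5 : 2 ^ L ≤ 2 * G.card := by
    rw [hXc] at g4
    have : (13 * 2 ^ (r + 8) + 1) * D.card = 13 * 2 ^ (r + 8) * D.card + D.card := by ring
    omega
  have g6 : G.card ≤ (4 * 2 ^ (2 * r)) * ((Finset.Ico (0 : ℤ) d) ×ˢ ((range L).powerset.filter (fun O => O.card ≤ 2 * r))).card := by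
    apply card_le_mul_card_image_of_maps_to (f := fun x => (f x, Os f S L x))
    · intro x hx
      rw [hG, mem_filter, hX, blk, mem_Ico] at hx
      obtain ⟨⟨x0, x1⟩, xD, xG, xc⟩ := hx
      have := hf x (by simpa using x0) (by simpa using x1) xD
      rw [mem_product, mem_Ico, mem_filter, mem_powerset]
      exact ⟨this, filter_subset _ _, Os_card h r x xG xc⟩
    · rintro ⟨v, O⟩ hb
      rw [mem_product, mem_filter] at hb
      have hO := hb.2.2
      have := class_le h r (G.filter (fun x => (f x, Os f S L x) = (v, O))) O v (by
        intro x hx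
        rw [mem_filter, hG, mem_filter, Prod.mk.injEq] at hx
        exact ⟨hx.1.2.2.1, hx.2.2, hx.2.1⟩) L le_rfl 0
      refine le_trans (card_le_card ?_) (this.trans ?_)
      · intro x hx
        rw [mem_filter]
        refine ⟨hx, ?_⟩
        have : x ∈ X := (mem_filter.mp (mem_filter.mp hx).1).1
        rw [hX, mem_blk] at this
        omega
      · apply Nat.mul_le_mul_left
        apply Nat.pow_le_pow_right (by norm_num)
        exact (card_filter_le _ _).trans hO
  rw [card_product, Int.card_Ico] at g6
  have g7 := patterns L (2 * r)
  have e : ((d : ℤ) - 0).toNat = d := by simp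
  rw [e] at g6
  calc 2 ^ L ≤ 2 * G.card := g5
    _ ≤ 2 * ((4 * 2 ^ (2 * r)) * (d * (L + 1) ^ (2 * r))) := by
      refine Nat.mul_le_mul_left _ (g6.trans ?_)
      gcongr
    _ = _ := by rw [mul_pow]; ring

end main
end Grate

namespace Grate
open Finset Classical

lemma union_bound {Ω ι : Type*} [Fintype Ω] (I : Finset ι) (A : ι → Finset Ω)
    (h : ∑ i ∈ I, (A i).card < Fintype.card Ω) : ∃ ω, ∀ i ∈ I, ω ∉ A i := by
  by_contra hcon
  push Not at hcon
  have : (univ : Finset Ω) ⊆ I.biUnion A := by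
    intro ω _
    rw [mem_biUnion]
    exact hcon ω
  have := (card_le_card this).trans card_biUnion_le
  rw [card_univ] at this
  omega

lemma geom_lt (m : ℕ) : ∑ i ∈ range m, ((1 : ℝ) / 2) ^ (i + 1) < 1 := by
  have : ∑ i ∈ range m, ((1 : ℝ) / 2) ^ (i + 1) = 1 - (1 / 2) ^ m := by
    induction m with
    | zero => simp
    | succ m ih => rw [sum_range_succ, ih, pow_succ]; ring
  rw [this]
  have : (0 : ℝ) < (1 / 2) ^ m := by positivity
  linarith

lemma design_card (L P : ℕ) (hP : 0 < P) (B : Finset (Fin P)) (K : Finset (Fin L)) :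
    ((Fintype.piFinset (fun ik : Fin 8 × Fin L => if ik.2 ∈ K then B else univ)).card : ℝ) =
      (P : ℝ) ^ (8 * L) * ((B.card : ℝ) / P) ^ (8 * K.card) := by
  rw [Fintype.card_piFinset]
  have hP' : (P : ℝ) ≠ 0 := by positivity
  push_cast
  have e : ∀ ik : Fin 8 × Fin L, (((if ik.2 ∈ K then B else univ : Finset (Fin P)).card : ℕ) : ℝ) =
      (P : ℝ) * (if ik.2 ∈ K then (B.card : ℝ) / P else 1) := by
    intro ik
    split_ifs
    · field_simp
    · simp
  simp_rw [e]
  rw [prod_mul_distrib]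
  congr 1
  · simp
  · rw [Fintype.prod_prod_type]
    simp [pow_mul]
    rw [← pow_mul, ← pow_mul, mul_comm]
    rw [← pow_mul, div_pow]

theorem design (L q : ℕ) (hq : 16 ≤ q) (hL : L < (q + 1) ^ 4) :
    ∃ H : Fin 8 → Fin L → Fin (q ^ 2), ∀ B : Finset (Fin (q ^ 2)), B.card ≤ q →
      ((univ : Finset (Fin L)).filter (fun k => ∀ i, H i k ∈ B)).card ≤ B.card := by
  set P := q ^ 2 with hPdef
  have hP : 0 < P := by positivity
  set I : Finset (Σ _ : ℕ, Finset (Fin P) × Finset (Fin L)) :=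
    (range (q + 1)).sigma (fun b => (powersetCard b (univ : Finset (Fin P))) ×ˢ
      (powersetCard (b + 1) (univ : Finset (Fin L)))) with hI
  have hub := union_bound (Ω := (Fin 8 × Fin L) → Fin P) I
    (fun t => Fintype.piFinset (fun ik : Fin 8 × Fin L => if ik.2 ∈ t.2.2 then t.2.1 else univ)) (by
    rw [← Nat.cast_lt (α := ℝ)]
    push_cast
    rw [hI, sum_sigma]
    have hcard : (Fintype.card ((Fin 8 × Fin L) → Fin P) : ℝ) = (P : ℝ) ^ (8 * L) := by simp
    rw [hcard]
    have hterm : ∀ b ∈ range (q + 1), ∑ t ∈ (powersetCard b (univ : Finset (Fin P))) ×ˢ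
      (powersetCard (b + 1) (univ : Finset (Fin L))),
        ((Fintype.piFinset (fun ik : Fin 8 × Fin L => if ik.2 ∈ t.2 then t.1 else univ)).card : ℝ)
        ≤ (P : ℝ) ^ (8 * L) * (1 / 2) ^ (b + 1) := by
      intro b hb
      have hbq : b ≤ q := by rw [mem_range] at hb; omega
      have : ∀ t ∈ (powersetCard b (univ : Finset (Fin P))) ×ˢ
        (powersetCard (b + 1) (univ : Finset (Fin L))),
        ((Fintype.piFinset (fun ik : Fin 8 × Fin L => if ik.2 ∈ t.2 then t.1 else univ)).card : ℝ)
        = (P : ℝ) ^ (8 * L) * ((b : ℝ) / P) ^ (8 * (b + 1)) := by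
        intro t ht
        rw [mem_product, mem_powersetCard, mem_powersetCard] at ht
        rw [design_card L P hP, ht.1.2, ht.2.2]
      rw [sum_congr rfl this, sum_const, card_product, card_powersetCard, card_powersetCard, nsmul_eq_mul]
      simp only [card_univ, Fintype.card_fin]
      rw [mul_left_comm]
      apply mul_le_mul_of_nonneg_left _ (by positivity)
      have hq0 : (16 : ℝ) ≤ q := by exact_mod_cast hq
      have c1 : (P.choose b : ℝ) ≤ (P : ℝ) ^ (b + 1) := by
        have : P.choose b ≤ P ^ (b + 1) :=
          (Nat.choose_le_pow P b).trans (Nat.pow_le_pow_right hP (by omega))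
        exact_mod_cast this
      have c2 : (L.choose (b + 1) : ℝ) ≤ (16 * (q : ℝ) ^ 4) ^ (b + 1) := by
        have h1 : L.choose (b + 1) ≤ L ^ (b + 1) := Nat.choose_le_pow L _
        have h2 : L ≤ 16 * q ^ 4 := by
          have : (q + 1) ^ 4 ≤ (2 * q) ^ 4 := Nat.pow_le_pow_left (by omega) 4
          rw [mul_pow] at this; omega
        have := h1.trans (Nat.pow_le_pow_left h2 _)
        exact_mod_cast this
      have c3 : (b : ℝ) / P ≤ 1 / q := by
        rw [hPdef]; push_cast
        rw [div_le_div_iff₀ (by positivity) (by positivity)]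
        have : (b : ℝ) ≤ q := by exact_mod_cast hbq
        nlinarith
      calc ((P.choose b * L.choose (b + 1) : ℕ) : ℝ) * ((b : ℝ) / P) ^ (8 * (b + 1))
          ≤ ((P : ℝ) ^ (b + 1) * (16 * (q : ℝ) ^ 4) ^ (b + 1)) * (1 / q) ^ (8 * (b + 1)) := by
            push_cast; gcongr
        _ = (P * (16 * (q : ℝ) ^ 4) * (1 / q) ^ 8) ^ (b + 1) := by
            rw [mul_pow ((P : ℝ) * (16 * (q : ℝ) ^ 4)), mul_pow (P : ℝ), ← pow_mul (1 / (q : ℝ))]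
        _ ≤ (1 / 2) ^ (b + 1) := by
            apply pow_le_pow_left₀ (by positivity)
            rw [hPdef]; push_cast
            have : (q : ℝ) ^ 2 * (16 * (q : ℝ) ^ 4) * (1 / q) ^ 8 = 16 / q ^ 2 := by
              field_simp
            rw [this, div_le_div_iff₀ (by positivity) (by positivity)]
            nlinarith
    refine lt_of_le_of_lt (sum_le_sum hterm) ?_
    rw [← mul_sum]
    have := geom_lt (q + 1)
    have hp : (0 : ℝ) < (P : ℝ) ^ (8 * L) := by positivity
    nlinarith)
  obtain ⟨H, hH⟩ := hub
  refine ⟨fun i k => H (i, k), ?_⟩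
  intro B hB
  by_contra hcon
  obtain ⟨K, hK1, hK2⟩ := exists_subset_card_eq (Nat.succ_le_of_lt (not_le.mp hcon))
  refine hH ⟨B.card, B, K⟩ ?_ ?_
  · rw [hI, mem_sigma, mem_product, mem_powersetCard, mem_powersetCard, mem_range]
    exact ⟨by simp only; omega, ⟨subset_univ _, rfl⟩, subset_univ _, hK2⟩
  · rw [Fintype.mem_piFinset]
    rintro ⟨i, k⟩
    simp only
    split_ifs with h
    · exact (mem_filter.mp (hK1 h)).2 i
    · exact mem_univ _

/-! permutations -/
noncomputable def PW {N : ℕ} (Z Y : Finset (Fin N)) : Finset (Equiv.Perm (Fin N)) :=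
  univ.filter (fun π => ∀ z ∈ Z, π z ∈ Y)

lemma PW_step {N : ℕ} (Y Z : Finset (Fin N)) (a : Fin N) (ha : a ∉ Z) :
    (PW (insert a Z) Y).card * (N - Z.card) ≤ (PW Z Y).card * (Y.card - Z.card) := by
  apply card_mul_le_card_mul (fun π σ => ∃ b ∉ Z, σ = π * Equiv.swap a b)
  · intro π hπ
    have hπ := (mem_filter.mp hπ).2
    have : (univ \ Z).image (fun b => π * Equiv.swap a b) ⊆
        bipartiteAbove (fun π σ => ∃ b ∉ Z, σ = π * Equiv.swap a b) (PW Z Y) π := by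
      intro σ hσ
      obtain ⟨b, hb, rfl⟩ := mem_image.mp hσ
      have hb : b ∉ Z := (mem_sdiff.mp hb).2
      rw [mem_bipartiteAbove]
      refine ⟨mem_filter.mpr ⟨mem_univ _, ?_⟩, b, hb, rfl⟩
      intro z hz
      rw [Equiv.Perm.mul_apply, Equiv.swap_apply_of_ne_of_ne]
      · exact hπ z (mem_insert_of_mem hz)
      · rintro rfl; exact ha hz
      · rintro rfl; exact hb hz
    refine le_trans (le_of_eq ?_) (card_le_card this)
    rw [card_image_of_injective, card_sdiff_of_subset (subset_univ _), card_univ, Fintype.card_fin]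
    intro b c h
    have := mul_left_cancel h
    have := congrArg (fun e : Equiv.Perm (Fin N) => e a) this
    simpa using this
  · intro σ hσ
    have hσ := (mem_filter.mp hσ).2
    have : bipartiteBelow (fun π σ => ∃ b ∉ Z, σ = π * Equiv.swap a b) (PW (insert a Z) Y) σ ⊆
        ((Y.image (σ⁻¹ : Equiv.Perm (Fin N))) \ Z).image (fun b => σ * Equiv.swap a b) := by
      intro π hπ
      rw [mem_bipartiteBelow] at hπ
      obtain ⟨h1, b, hb, rfl⟩ := hπ
      have h1 := (mem_filter.mp h1).2 a (mem_insert_self _ _)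
      rw [mem_image]
      refine ⟨b, ?_, ?_⟩
      · rw [mem_sdiff, mem_image]
        refine ⟨⟨π a, h1, ?_⟩, hb⟩
        rw [Equiv.Perm.inv_eq_iff_eq]
        simp
      · simp [mul_assoc]
    refine (card_le_card this).trans (card_image_le.trans (le_of_eq ?_))
    rw [card_sdiff_of_subset, card_image_of_injective _ (Equiv.injective _)]
    intro z hz
    rw [mem_image]
    exact ⟨σ z, hσ z hz, by simp⟩

lemma PW_card {N : ℕ} (Y Z : Finset (Fin N)) :
    (PW Z Y).card * N ^ Z.card ≤ Y.card ^ Z.card * N.factorial := by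
  induction Z using Finset.induction_on with
  | empty => simp [PW, Fintype.card_perm]
  | insert a Z ha ih =>
    rw [card_insert_of_notMem ha]
    have h1 := PW_step Y Z a ha
    have hz : Z.card < N := by
      have : (insert a Z).card ≤ N := by simpa using card_le_univ (insert a Z)
      rw [card_insert_of_notMem ha] at this; omega
    have hy : Y.card ≤ N := by simpa using card_le_univ Y
    have h2 : (Y.card - Z.card) * N ≤ Y.card * (N - Z.card) := by
      rcases Nat.le_total Y.card Z.card with h | h
      · rw [Nat.sub_eq_zero_of_le h]; simp
      · zify [h, hz.le]
        have : (Y.card : ℤ) ≤ N := by exact_mod_cast hy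
        nlinarith [Int.natCast_nonneg Z.card]
    have h3 : (PW (insert a Z) Y).card * N ≤ (PW Z Y).card * Y.card := by
      have hpos : 0 < N - Z.card := by omega
      refine Nat.le_of_mul_le_mul_right ?_ hpos
      calc (PW (insert a Z) Y).card * N * (N - Z.card)
          = (PW (insert a Z) Y).card * (N - Z.card) * N := by ring
        _ ≤ (PW Z Y).card * (Y.card - Z.card) * N := Nat.mul_le_mul_right _ h1
        _ = (PW Z Y).card * ((Y.card - Z.card) * N) := by ring
        _ ≤ (PW Z Y).card * (Y.card * (N - Z.card)) := Nat.mul_le_mul_left _ h2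
        _ = _ := by ring
    calc (PW (insert a Z) Y).card * N ^ (Z.card + 1)
        = ((PW (insert a Z) Y).card * N) * N ^ Z.card := by rw [pow_succ]; ring
      _ ≤ ((PW Z Y).card * Y.card) * N ^ Z.card := Nat.mul_le_mul_right _ h3
      _ = ((PW Z Y).card * N ^ Z.card) * Y.card := by ring
      _ ≤ (Y.card ^ Z.card * N.factorial) * Y.card := Nat.mul_le_mul_right _ ih
      _ = _ := by rw [pow_succ]; ring

lemma choose_bd (N j : ℕ) (hj : 0 < j) : (N.choose j : ℝ) ≤ (3 * (N : ℝ) / j) ^ j := by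
  have h1 := Real.pow_div_factorial_le_exp (j : ℝ) (by positivity) j
  have h2 : (N.choose j : ℝ) ≤ (N : ℝ) ^ j / j.factorial := Nat.choose_le_pow_div j N
  have h3 : Real.exp j ≤ 3 ^ j := by
    have : Real.exp (j : ℝ) = Real.exp 1 ^ j := by rw [← Real.exp_nat_mul]; simp
    rw [this]
    apply pow_le_pow_left₀ (Real.exp_pos _).le
    have := Real.exp_one_lt_d9
    linarith
  have hf : (0 : ℝ) < j.factorial := by positivity
  have hj' : (0 : ℝ) < (j : ℝ) ^ j := by positivity
  have h4 := h1.trans h3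
  rw [div_le_iff₀ hf] at h4
  refine h2.trans ?_
  rw [div_pow, mul_pow, div_le_div_iff₀ hf hj']
  have : (0 : ℝ) ≤ (N : ℝ) ^ j := by positivity
  nlinarith

set_option exponentiation.threshold 500 in
lemma num_bd : (16 : ℝ) * 3 ^ 17 * (15 / 16) ^ 383 ≤ 1 / 2 := by norm_num

lemma term_bd (N z : ℕ) (hz : 0 < z) (hzN : 256 * z ≤ 15 * N) :
    (N.choose z : ℝ) * N.choose (16 * z) * (((16 * z : ℕ) : ℝ) / N) ^ (z * 400) ≤ (1 / 2) ^ z := by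
  have hN : 0 < N := by omega
  have h1 := choose_bd N z hz
  have h2 := choose_bd N (16 * z) (by omega)
  set u : ℝ := ((16 * z : ℕ) : ℝ) / N with hu
  have hN' : (0 : ℝ) < N := by exact_mod_cast hN
  have hz' : (0 : ℝ) < z := by exact_mod_cast hz
  have hu0 : 0 < u := by rw [hu]; positivity
  have hu1 : u ≤ 15 / 16 := by
    rw [hu, div_le_div_iff₀ hN' (by norm_num)]
    have : (256 * z : ℝ) ≤ 15 * N := by exact_mod_cast hzN
    push_cast; linarith
  have e1 : 3 * (N : ℝ) / z = 48 * u⁻¹ := by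
    rw [hu]; push_cast; field_simp; norm_num
  have e2 : 3 * (N : ℝ) / ((16 * z : ℕ) : ℝ) = 3 * u⁻¹ := by
    rw [hu]; push_cast; field_simp
  rw [e1] at h1
  rw [e2] at h2
  calc (N.choose z : ℝ) * N.choose (16 * z) * u ^ (z * 400)
      ≤ (48 * u⁻¹) ^ z * (3 * u⁻¹) ^ (16 * z) * u ^ (z * 400) := by gcongr
    _ = ((48 * u⁻¹) * (3 * u⁻¹) ^ 16 * u ^ 400) ^ z := by
      rw [mul_pow (48 * u⁻¹ * (3 * u⁻¹) ^ 16), mul_pow (48 * u⁻¹), ← pow_mul, ← pow_mul, mul_comm 400 z]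
    _ = (16 * 3 ^ 17 * u ^ 383) ^ z := by
      congr 1
      have : u ^ 400 = u ^ 17 * u ^ 383 := by rw [← pow_add]
      rw [this]
      field_simp
      norm_num
    _ ≤ (1 / 2) ^ z := by
      apply pow_le_pow_left₀ (by positivity)
      refine le_trans ?_ num_bd
      gcongr

theorem perms_exist (N : ℕ) (hN : 0 < N) : ∃ π : Fin 400 → Equiv.Perm (Fin N), ∀ Z : Finset (Fin N),
    256 * Z.card ≤ 15 * N → 16 * Z.card ≤ (univ.filter (fun y => ∃ j, ∃ z ∈ Z, π j z = y)).card := by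
  set I : Finset (Σ _ : ℕ, Finset (Fin N) × Finset (Fin N)) :=
    ((range N).filter (fun i => 256 * (i + 1) ≤ 15 * N)).sigma
      (fun i => (powersetCard (i + 1) (univ : Finset (Fin N))) ×ˢ
      (powersetCard (16 * (i + 1)) (univ : Finset (Fin N)))) with hI
  have hub := union_bound (Ω := Fin 400 → Equiv.Perm (Fin N)) I
    (fun t => Fintype.piFinset (fun _ : Fin 400 => PW t.2.1 t.2.2)) (by
    rw [← Nat.cast_lt (α := ℝ)]
    push_cast
    rw [hI, sum_sigma]
    have hcard : (Fintype.card (Fin 400 → Equiv.Perm (Fin N)) : ℝ) = (N.factorial : ℝ) ^ 400 := by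
      simp [Fintype.card_perm]
    rw [hcard]
    have hterm : ∀ i ∈ (range N).filter (fun i => 256 * (i + 1) ≤ 15 * N),
        ∑ t ∈ (powersetCard (i + 1) (univ : Finset (Fin N))) ×ˢ
          (powersetCard (16 * (i + 1)) (univ : Finset (Fin N))),
        ((Fintype.piFinset (fun _ : Fin 400 => PW t.1 t.2)).card : ℝ)
        ≤ (N.factorial : ℝ) ^ 400 * (1 / 2) ^ (i + 1) := by
      intro i hi
      have hi := (mem_filter.mp hi).2
      have hN' : (0 : ℝ) < N := by exact_mod_cast hN
      have : ∀ t ∈ (powersetCard (i + 1) (univ : Finset (Fin N))) ×ˢ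
          (powersetCard (16 * (i + 1)) (univ : Finset (Fin N))),
        ((Fintype.piFinset (fun _ : Fin 400 => PW t.1 t.2)).card : ℝ)
        ≤ (N.factorial : ℝ) ^ 400 * (((16 * (i + 1) : ℕ) : ℝ) / N) ^ ((i + 1) * 400) := by
        intro t ht
        rw [mem_product, mem_powersetCard, mem_powersetCard] at ht
        have h1 := PW_card t.2 t.1
        rw [ht.1.2, ht.2.2] at h1
        have h2 : ((PW t.1 t.2).card : ℝ) ≤ N.factorial * (((16 * (i + 1) : ℕ) : ℝ) / N) ^ (i + 1) := by
          rw [div_pow, ← mul_div_assoc, le_div_iff₀ (by positivity), mul_comm (N.factorial : ℝ)]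
          exact_mod_cast h1
        rw [Fintype.card_piFinset]
        simp only [prod_const, card_univ, Fintype.card_fin]
        push_cast
        rw [pow_mul, ← mul_pow]
        refine pow_le_pow_left₀ (by positivity) ?_ _
        exact_mod_cast h2
      refine (sum_le_sum this).trans ?_
      rw [sum_const, card_product, card_powersetCard, card_powersetCard, nsmul_eq_mul]
      simp only [card_univ, Fintype.card_fin]
      rw [mul_left_comm]
      apply mul_le_mul_of_nonneg_left _ (by positivity)
      have := term_bd N (i + 1) (by omega) hi
      push_cast at this ⊢
      exact this
    refine lt_of_le_of_lt (sum_le_sum hterm) ?_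
    rw [← mul_sum]
    have h1 : ∑ i ∈ (range N).filter (fun i => 256 * (i + 1) ≤ 15 * N), ((1 : ℝ) / 2) ^ (i + 1) ≤
        ∑ i ∈ range N, ((1 : ℝ) / 2) ^ (i + 1) :=
      sum_le_sum_of_subset_of_nonneg (filter_subset _ _) (fun _ _ _ => by positivity)
    have := geom_lt N
    have hp : (0 : ℝ) < (N.factorial : ℝ) ^ 400 := by positivity
    generalize (N.factorial : ℝ) ^ 400 = T at *
    nlinarith)
  obtain ⟨π, hπ⟩ := hub
  refine ⟨π, ?_⟩
  intro Z hZ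
  by_contra hcon
  have hz : 0 < Z.card := by omega
  obtain ⟨Y, hY1, hY2⟩ := exists_superset_card_eq (s := univ.filter (fun y => ∃ j, ∃ z ∈ Z, π j z = y))
    (n := 16 * Z.card) (by omega) (by simp only [Fintype.card_fin]; omega)
  refine hπ ⟨Z.card - 1, Z, Y⟩ ?_ ?_
  · rw [hI, mem_sigma, mem_product, mem_powersetCard, mem_powersetCard, mem_filter, mem_range]
    have : Z.card ≤ N := by simpa using card_le_univ Z
    have e : Z.card - 1 + 1 = Z.card := by omega
    simp only [e]
    exact ⟨⟨by omega, hZ⟩, ⟨subset_univ _, trivial⟩, subset_univ _, hY2⟩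
  · rw [Fintype.mem_piFinset]
    intro j
    refine mem_filter.mpr ⟨mem_univ _, ?_⟩
    intro z hz
    exact hY1 (mem_filter.mpr ⟨mem_univ _, j, z, hz, rfl⟩)

end Grate

namespace Grate
open Finset Classical

def NB (N : ℕ) (nb : Fin 1024 → Fin N → Fin N) : Prop :=
  (∀ Z : Finset (Fin N), min (256 * Z.card) (14 * N) ≤ 16 * (univ.filter (fun y => ∃ j, nb j y ∈ Z)).card) ∧
  (∀ Y : Finset (Fin N), min (256 * Y.card) (14 * N) ≤
    16 * (univ.filter (fun x => ∃ y ∈ Y, ∃ j, nb j y = x)).card)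

lemma nb_exists (N : ℕ) (hN : 0 < N) : ∃ nb, NB N nb := by
  by_cases hs : N ≤ 1024
  · refine ⟨fun j _ => ⟨j % N, Nat.mod_lt _ hN⟩, ?_, ?_⟩
    · intro Z
      rcases Z.eq_empty_or_nonempty with rfl | ⟨z, hz⟩
      · simp
      · have : (univ.filter (fun y : Fin N => ∃ j : Fin 1024, (⟨j % N, Nat.mod_lt _ hN⟩ : Fin N) ∈ Z)) = univ := by
          apply filter_true_of_mem
          intro y _
          refine ⟨⟨z, by omega⟩, ?_⟩
          convert hz
          exact Nat.mod_eq_of_lt z.2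
        rw [this, card_univ, Fintype.card_fin]; omega
    · intro Z
      rcases Z.eq_empty_or_nonempty with rfl | ⟨z, hz⟩
      · simp
      · have : (univ.filter (fun x : Fin N => ∃ y ∈ Z, ∃ j : Fin 1024, (⟨j % N, Nat.mod_lt _ hN⟩ : Fin N) = x)) = univ := by
          apply filter_true_of_mem
          intro x _
          refine ⟨z, hz, ⟨x, by omega⟩, ?_⟩
          apply Fin.ext
          exact Nat.mod_eq_of_lt x.2
        rw [this, card_univ, Fintype.card_fin]; omega
  · obtain ⟨π, hπ⟩ := perms_exist N hN
    have key : ∀ Z : Finset (Fin N), min (256 * Z.card) (14 * N) ≤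
        16 * (univ.filter (fun y => ∃ j, ∃ z ∈ Z, π j z = y)).card := by
      intro Z
      by_cases h : 256 * Z.card ≤ 15 * N
      · have := hπ Z h; omega
      · obtain ⟨Z0, h1, h2⟩ := exists_subset_card_eq (s := Z) (n := 15 * N / 256) (by omega)
        have h3 := hπ Z0 (by omega)
        have h4 : (univ.filter (fun y => ∃ j, ∃ z ∈ Z0, π j z = y)).card ≤
            (univ.filter (fun y => ∃ j, ∃ z ∈ Z, π j z = y)).card := by
          apply card_le_card
          intro y
          rw [mem_filter, mem_filter]
          rintro ⟨h, j, z, hz, e⟩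
          exact ⟨h, j, z, h1 hz, e⟩
        omega
    refine ⟨fun j y => if h : j.1 < 400 then π ⟨j, h⟩ y else if h' : j.1 < 800 then
      (π ⟨j.1 - 400, by omega⟩)⁻¹ y else y, ?_, ?_⟩
    · intro Z
      refine (key Z).trans (Nat.mul_le_mul_left _ (card_le_card ?_))
      intro y
      rw [mem_filter, mem_filter]
      rintro ⟨h, j, z, hz, rfl⟩
      refine ⟨h, ⟨j + 400, by omega⟩, ?_⟩
      have h1 : ¬ (j.1 + 400 < 400) := by omega
      have h2 : j.1 + 400 < 800 := by omega
      simp only [h1, h2, dif_pos, dif_neg, not_false_eq_true, Nat.add_sub_cancel]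
      simpa using hz
    · intro Z
      refine (key Z).trans (Nat.mul_le_mul_left _ (card_le_card ?_))
      intro y
      rw [mem_filter, mem_filter]
      rintro ⟨h, j, z, hz, rfl⟩
      refine ⟨h, z, hz, ⟨j, by omega⟩, ?_⟩
      simp [j.2]

noncomputable def tf (k : ℕ) (y : ℤ) : Fin (2 ^ k) :=
  ⟨(y % 2 ^ k).toNat, by
    have h : (0 : ℤ) < 2 ^ k := by positivity
    have h2 := Int.emod_nonneg y h.ne'
    have h3 := Int.emod_lt_of_pos y h
    zify
    rw [Int.toNat_of_nonneg h2]
    exact_mod_cast h3⟩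

def ff (k : ℕ) (p : ℤ) (i : Fin (2 ^ k)) : ℤ := p * 2 ^ k + i.1

lemma ff_div (k : ℕ) (p : ℤ) (i : Fin (2 ^ k)) : ff k p i / 2 ^ k = p := by
  rw [← mem_blk, blk, mem_Ico]
  have : (i.1 : ℤ) < 2 ^ k := by exact_mod_cast i.2
  unfold ff
  constructor
  · omega
  · linarith

lemma ff_tf (k : ℕ) (p y : ℤ) (h : y / 2 ^ k = p) : ff k p (tf k y) = y := by
  unfold ff tf
  have h0 : (0 : ℤ) < 2 ^ k := by positivity
  simp only
  rw [Int.toNat_of_nonneg (Int.emod_nonneg y h0.ne'), ← h]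
  have := Int.emod_add_mul_ediv y (2 ^ k)
  linarith

lemma ff_inj (k : ℕ) (p : ℤ) : Function.Injective (ff k p) := by
  intro i j h
  unfold ff at h
  apply Fin.ext
  omega

lemma tf_ff (k : ℕ) (p : ℤ) (i : Fin (2 ^ k)) : tf k (ff k p i) = i :=
  ff_inj k p (ff_tf k p _ (ff_div k p i))

lemma tf_card (k : ℕ) (p : ℤ) (Z : Finset ℤ) (hZ : Z ⊆ blk k p) : (Z.image (tf k)).card = Z.card := by
  apply card_image_of_injOn
  intro x hx y hy h
  rw [← ff_tf k p x (mem_blk.mp (hZ hx)), ← ff_tf k p y (mem_blk.mp (hZ hy)), h]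

def EE (nb : ℕ → Fin 1024 → ℤ → ℤ) (k : ℕ) (x y : ℤ) : Prop := ∃ j, x = nb k j y

theorem inb_exists : ∃ nb : ℕ → Fin 1024 → ℤ → ℤ,
    (∀ k j y, nb k j y / 2 ^ k = y / 2 ^ k - 1) ∧
    (∀ k, ExpF (EE nb k) k) ∧
    (∀ k, ExpF (fun x y => EE nb k (rv y) (rv x)) k) := by
  choose nb hnb using fun k : ℕ => nb_exists (2 ^ k) (by positivity)
  refine ⟨fun k j y => ff k (y / 2 ^ k - 1) (nb k j (tf k y)), ?_, ?_, ?_⟩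
  · intro k j y; exact ff_div _ _ _
  · intro k p Z hZ
    have h := (hnb k).1 (Z.image (tf k))
    rw [tf_card k p Z hZ] at h
    refine h.trans (Nat.mul_le_mul_left _ ?_)
    rw [← card_image_of_injective _ (ff_inj k (p + 1))]
    apply card_le_card
    intro y hy
    obtain ⟨i, hi, rfl⟩ := mem_image.mp hy
    obtain ⟨_, j, hj⟩ := mem_filter.mp hi
    obtain ⟨z, hz, hzj⟩ := mem_image.mp hj
    refine mem_filter.mpr ⟨mem_blk.mpr (ff_div _ _ _), z, hz, j, ?_⟩
    show z = ff k (ff k (p + 1) i / 2 ^ k - 1) (nb k j (tf k (ff k (p + 1) i)))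
    have e1 := ff_tf k p z (mem_blk.mp (hZ hz))
    have e2 := ff_div k (p + 1) i
    have e3 := tf_ff k (p + 1) i
    have e4 : p + 1 - 1 = p := by ring
    rw [e2, e3, e4, ← hzj]
    exact e1.symm
  · intro k p Z hZ
    have hZ' : rvs Z ⊆ blk k (rv p) := by
      intro x hx
      rw [← blk_rvs, mem_rvs]
      exact hZ (mem_rvs.mp hx)
    have h := (hnb k).2 ((rvs Z).image (tf k))
    rw [tf_card k (rv p) _ hZ', card_rvs] at h
    refine h.trans (Nat.mul_le_mul_left _ ?_)
    rw [← card_image_of_injective _ (ff_inj k (rv p - 1)), ← card_rvs]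
    apply card_le_card
    intro y hy
    rw [mem_rvs] at hy
    obtain ⟨i, hi, hi2⟩ := mem_image.mp hy
    obtain ⟨_, y', hy', j, hj⟩ := mem_filter.mp hi
    obtain ⟨z, hz, rfl⟩ := mem_image.mp hy'
    have hzd : z / 2 ^ k = rv p := mem_blk.mp (hZ' hz)
    refine mem_filter.mpr ⟨mem_blk.mpr ?_, rv z, mem_rvs.mp hz, j, ?_⟩
    · have := ff_div k (rv p - 1) i
      rw [hi2, rv_div] at this
      unfold rv at this; omega
    · show rv y = ff k (rv (rv z) / 2 ^ k - 1) (nb k j (tf k (rv (rv z))))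
      have e1 := rv_rv z
      rw [e1, hj, hzd]
      exact hi2.symm

end Grate

namespace Grate
open Finset Classical

lemma labels {V : Type*} (Adj : V → V → Prop) (S : Finset V) (d : ℕ)
    (h : ¬ ∃ p : List V, PathIn Adj p ∧ (∀ v ∈ p, v ∉ S) ∧ p.length = d + 1) :
    ∃ F : V → ℕ, (∀ v, v ∉ S → F v < d) ∧ (∀ u v, u ∉ S → v ∉ S → Adj u v → F u < F v) := by
  set Q : V → ℕ → Prop := fun v l => ∃ p : List V, PathIn Adj p ∧ (∀ v ∈ p, v ∉ S) ∧
    p.getLast? = some v ∧ p.length = l + 1 with hQ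
  have h0 : ∀ v, v ∉ S → Q v 0 := by
    intro v hv
    exact ⟨[v], ⟨by simp, List.isChain_singleton v⟩, by simpa using hv, by simp, by simp⟩
  have hsp : ∀ v, v ∉ S → Q v (Nat.findGreatest (Q v) d) := fun v hv =>
    Nat.findGreatest_spec (P := Q v) (Nat.zero_le d) (h0 v hv)
  have hlt : ∀ v, v ∉ S → Nat.findGreatest (Q v) d < d := by
    intro v hv
    refine lt_of_le_of_ne (Nat.findGreatest_le d) ?_
    intro he
    have := hsp v hv
    rw [he] at this
    obtain ⟨p, h1, h2, _, h4⟩ := this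
    exact h ⟨p, h1, h2, h4⟩
  refine ⟨fun v => Nat.findGreatest (Q v) d, hlt, ?_⟩
  intro u v hu hv huv
  obtain ⟨p, h1, h2, h3, h4⟩ := hsp u hu
  have : Q v (Nat.findGreatest (Q u) d + 1) := by
    refine ⟨p ++ [v], ⟨by simp, ?_⟩, ?_, by simp, by simp [h4]⟩
    · refine List.isChain_append.mpr ⟨h1.2, List.isChain_singleton v, ?_⟩
      intro x hx y hy
      rw [h3] at hx
      simp at hx hy
      subst hx; subst hy; exact huv
    · intro x hx
      rw [List.mem_append] at hx
      rcases hx with hx | hx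
      · exact h2 x hx
      · simp at hx; subst hx; exact hv
  exact Nat.le_findGreatest (P := Q v) (hlt u hu) this

abbrev Loc (L P : ℕ) := Fin L ⊕ ((Fin 8 × Fin L) ⊕ (Fin P × Fin P))
abbrev Vt (L P : ℕ) := Fin (2 ^ L) × Loc L P
abbrev port {L P : ℕ} (w : Fin (2 ^ L)) (k : Fin L) : Vt L P := (w, Sum.inl k)
abbrev sup' {L P : ℕ} (w : Fin (2 ^ L)) (i : Fin 8) (k : Fin L) : Vt L P := (w, Sum.inr (Sum.inl (i, k)))
abbrev core {L P : ℕ} (w : Fin (2 ^ L)) (t c : Fin P) : Vt L P := (w, Sum.inr (Sum.inr (t, c)))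

section graph
variable {L P : ℕ} (nb : ℕ → Fin 1024 → ℤ → ℤ) (H : Fin 8 → Fin L → Fin P)

inductive AdC : Fin 1024 × Fin 8 → Vt L P → Vt L P → Prop
  | cp (x w : Fin (2 ^ L)) (k : Fin L) (t c : Fin P) (j : Fin 1024) (i : Fin 8)
      (hx : ((x : ℕ) : ℤ) = nb k j ((w : ℕ) : ℤ)) (ht : t = H i k) (hc : (c : ℕ) + 1 = P) :
      AdC (j, i) (core x t c) (port w k)
  | ps (w : Fin (2 ^ L)) (k : Fin L) (i : Fin 8) : AdC (0, 0) (port w k) (sup' w i k)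
  | ss (w : Fin (2 ^ L)) (i : Fin 8) (k' k : Fin L) (h : k' < k) (hs : H i k' = H i k)
      (hn : ∀ j, k' < j → j < k → H i j ≠ H i k) : AdC (1, 0) (sup' w i k') (sup' w i k)
  | sc (w : Fin (2 ^ L)) (i : Fin 8) (k : Fin L) (t c : Fin P) (hc : H i k = c)
      (hl : ∀ j, k < j → H i j ≠ c) : AdC (1, i) (sup' w i k) (core w t c)
  | cc (w : Fin (2 ^ L)) (t c c' : Fin P) (h : (c : ℕ) + 1 = c') : AdC (0, 0) (core w t c) (core w t c')

def Ad (u v : Vt L P) : Prop := ∃ c, AdC nb H c u v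

lemma AdC_fun (c : Fin 1024 × Fin 8) (u u' v : Vt L P) (h : AdC nb H c u v) (h' : AdC nb H c u' v) : u = u' := by
  cases h with
  | cp x w k t c j i hx ht hc =>
    cases h' with
    | cp x' _ _ t' c' _ _ hx' ht' hc' =>
      have e1 : x = x' := by apply Fin.ext; have := hx.trans hx'.symm; exact_mod_cast this
      have e2 : c = c' := by apply Fin.ext; omega
      rw [e1, e2, ht, ht']
  | ps w k i =>
    cases h' with
    | ps => rfl
  | ss w i k' k h hs hn =>
    cases h' with
    | ss _ _ k'' _ h' hs' hn' =>
      have : k' = k'' := by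
        rcases lt_trichotomy k' k'' with hh | hh | hh
        · exact absurd hs' (hn k'' hh h')
        · exact hh
        · exact absurd hs (hn' k' hh h)
      rw [this]
  | sc w i k t c hc hl =>
    cases h' with
    | sc _ _ k' _ _ hc' hl' =>
      have : k = k' := by
        rcases lt_trichotomy k k' with hh | hh | hh
        · exact absurd hc' (hl k' hh)
        · exact hh
        · exact absurd hc (hl' k hh)
      rw [this]
  | cc w t c c' h =>
    cases h' with
    | cc _ _ c'' _ h' =>
      have : c = c'' := by apply Fin.ext; omega
      rw [this]

lemma Ad_indeg (v : Vt L P) : indeg (Ad nb H) v ≤ 8192 := by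
  unfold indeg
  choose g hg using fun u : {u // Ad nb H u v} => u.2
  have : Function.Injective g := by
    intro a b hab
    apply Subtype.ext
    have ha := hg a
    rw [hab] at ha
    exact AdC_fun nb H _ _ _ _ ha (hg b)
  have := Nat.card_le_card_of_injective g this
  rw [Nat.card_eq_fintype_card (α := Fin 1024 × Fin 8)] at this
  simpa using this

def rk (v : Vt L P) : ℕ := v.1 * (L + P + 2) + (match v.2 with
  | Sum.inl _ => 0
  | Sum.inr (Sum.inl ik) => 1 + ik.2
  | Sum.inr (Sum.inr tc) => 1 + L + tc.2)

lemma nb_lt (hnb : ∀ k j y, nb k j y / 2 ^ k = y / 2 ^ k - 1) (k : ℕ) (j : Fin 1024) (y : ℤ) : nb k j y < y := by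
  have := hnb k j y
  by_contra hcon
  have h2 : y / 2 ^ k ≤ nb k j y / 2 ^ k := Int.ediv_le_ediv (by positivity) (not_lt.mp hcon)
  omega

lemma Ad_rk (hnb : ∀ k j y, nb k j y / 2 ^ k = y / 2 ^ k - 1) (u v : Vt L P) (h : Ad nb H u v) : rk u < rk v := by
  obtain ⟨c, h⟩ := h
  cases h with
  | cp x w k t c j i hx ht hc =>
    have := nb_lt nb hnb k j w
    rw [← hx] at this
    have hxw : (x : ℕ) + 1 ≤ w := by omega
    have := Nat.mul_le_mul_right (L + P + 2) hxw
    have := c.2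
    simp only [rk]
    rw [add_mul] at *
    omega
  | ps w k i => simp [rk]
  | ss w i k' k h hs hn => simp only [rk]; have : (k' : ℕ) < k := h; omega
  | sc w i k t c hc hl => simp only [rk]; have := k.2; omega
  | cc w t c c' h => simp only [rk]; omega

lemma acyclic_of_rk {V : Type*} (Adj : V → V → Prop) (rk : V → ℕ) (h : ∀ u v, Adj u v → rk u < rk v) :
    Acyclic Adj := by
  intro v hv
  have : ∀ u w, Relation.TransGen Adj u w → rk u < rk w := by
    intro u w huw
    induction huw with
    | single h1 => exact h _ _ h1
    | tail _ h2 ih => exact ih.trans (h _ _ h2)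
  exact lt_irrefl _ (this v v hv)

lemma card_Vt : Nat.card (Vt L P) = 2 ^ L * (9 * L + P * P) := by
  rw [Nat.card_eq_fintype_card]
  simp only [Fintype.card_prod, Fintype.card_sum, Fintype.card_fin]
  ring

variable (S : Finset (Vt L P))

noncomputable def s1 (w : Fin (2 ^ L)) : Finset (Fin L) := univ.filter (fun k => port w k ∈ S)
noncomputable def s2 (w : Fin (2 ^ L)) : Finset (Fin 8 × Fin L) := univ.filter (fun ik => sup' w ik.1 ik.2 ∈ S)
noncomputable def s3 (w : Fin (2 ^ L)) : Finset (Fin P × Fin P) := univ.filter (fun tc => core w tc.1 tc.2 ∈ S)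
noncomputable def del (w : Fin (2 ^ L)) : ℕ := (S.filter (fun v => v.1 = w)).card
noncomputable def bs (w : Fin (2 ^ L)) : Finset (Fin P) := (s2 S w).image (fun ik => H ik.1 ik.2)
noncomputable def bc (w : Fin (2 ^ L)) : Finset (Fin P) := (s3 S w).image (fun tc => tc.1)

lemma s_le (w : Fin (2 ^ L)) : (s1 S w).card + (s2 S w).card + (s3 S w).card ≤ del S w := by
  have e : (s1 S w).card + (s2 S w).card + (s3 S w).card =
      (((s1 S w).disjSum ((s2 S w).disjSum (s3 S w))).image (fun l => ((w, l) : Vt L P))).card := by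
    rw [card_image_of_injective _ (fun a b h => (Prod.mk.inj h).2), card_disjSum, card_disjSum]
    omega
  rw [e]
  unfold del
  apply card_le_card
  intro v hv
  obtain ⟨l, hl, rfl⟩ := mem_image.mp hv
  refine mem_filter.mpr ⟨?_, rfl⟩
  rcases l with k | ik | tc
  · rw [inl_mem_disjSum] at hl; exact (mem_filter.mp hl).2
  · rw [inr_mem_disjSum, inl_mem_disjSum] at hl; exact (mem_filter.mp hl).2
  · rw [inr_mem_disjSum, inr_mem_disjSum] at hl; exact (mem_filter.mp hl).2

def Lost (w : Fin (2 ^ L)) (k : Fin L) : Prop :=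
  port w k ∈ S ∨ (∀ i, H i k ∈ bs H S w) ∨ (∀ i, H i k ∈ bc S w)

lemma lost_le (q : ℕ) (hH : ∀ B : Finset (Fin P), B.card ≤ q →
      ((univ : Finset (Fin L)).filter (fun k => ∀ i, H i k ∈ B)).card ≤ B.card)
    (w : Fin (2 ^ L)) (hw : del S w ≤ q) :
    ((univ : Finset (Fin L)).filter (fun k => Lost H S w k)).card ≤ del S w := by
  have h0 := s_le S w
  have h2 : (bs H S w).card ≤ (s2 S w).card := card_image_le
  have h3 : (bc S w).card ≤ (s3 S w).card := card_image_le
  have h4 := hH (bs H S w) (by omega)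
  have h5 := hH (bc S w) (by omega)
  have : (univ : Finset (Fin L)).filter (fun k => Lost H S w k) ⊆ s1 S w ∪
      ((univ : Finset (Fin L)).filter (fun k => ∀ i, H i k ∈ bs H S w) ∪
      (univ : Finset (Fin L)).filter (fun k => ∀ i, H i k ∈ bc S w)) := by
    intro k hk
    rw [mem_filter] at hk
    rw [mem_union, mem_union, mem_filter, mem_filter]
    rcases hk.2 with h | h | h
    · left; exact mem_filter.mpr ⟨mem_univ _, h⟩
    · right; left; exact ⟨mem_univ _, h⟩
    · right; right; exact ⟨mem_univ _, h⟩
  have h6 := (card_le_card this).trans (card_union_le _ _)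
  have h7 := card_union_le ((univ : Finset (Fin L)).filter (fun k => ∀ i, H i k ∈ bs H S w))
      ((univ : Finset (Fin L)).filter (fun k => ∀ i, H i k ∈ bc S w))
  omega

lemma core_alive (w : Fin (2 ^ L)) (t c : Fin P) (ht : t ∉ bc S w) : core w t c ∉ S := by
  intro h
  apply ht
  exact mem_image.mpr ⟨(t, c), mem_filter.mpr ⟨mem_univ _, h⟩, rfl⟩

lemma sup_alive (w : Fin (2 ^ L)) (i : Fin 8) (k : Fin L) (ht : H i k ∉ bs H S w) : sup' w i k ∉ S := by
  intro h
  apply ht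
  exact mem_image.mpr ⟨(i, k), mem_filter.mpr ⟨mem_univ _, h⟩, rfl⟩

lemma sup_core (F : Vt L P → ℕ) (hF : ∀ u v, u ∉ S → v ∉ S → Ad nb H u v → F u < F v)
    (w : Fin (2 ^ L)) (i : Fin 8) (c : Fin P) (hc : c ∉ bs H S w) (t : Fin P) (ht : t ∉ bc S w) :
    ∀ m : ℕ, ∀ k : Fin L, L ≤ k + m → H i k = c → F (sup' w i k) < F (core w t c) := by
  intro m
  induction m with
  | zero => intro k hk _; have := k.2; omega
  | succ m ih =>
    intro k hk hkc
    have hka : sup' w i k ∉ S := sup_alive H S w i k (hkc ▸ hc)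
    by_cases hl : ∀ j, k < j → H i j ≠ c
    · exact hF _ _ hka (core_alive S w t c ht) ⟨_, AdC.sc w i k t c hkc hl⟩
    · push Not at hl
      obtain ⟨j0, h1, h2⟩ := hl
      obtain ⟨j, hj, hmin⟩ := exists_min_image (univ.filter (fun j => k < j ∧ H i j = c)) id
        ⟨j0, mem_filter.mpr ⟨mem_univ _, h1, h2⟩⟩
      obtain ⟨_, hj1, hj2⟩ := mem_filter.mp hj
      have hja : sup' w i j ∉ S := sup_alive H S w i j (hj2 ▸ hc)
      have e := hF _ _ hka hja ⟨_, AdC.ss w i k j hj1 (hkc.trans hj2.symm) (by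
        intro l hl1 hl2 hl3
        have := hmin l (mem_filter.mpr ⟨mem_univ _, hl1, hl3.trans hj2⟩)
        exact absurd hl2 (not_lt.mpr this))⟩
      have hkj : (k : ℕ) < j := hj1
      exact e.trans (ih j (by omega) hj2)

lemma core_core (F : Vt L P → ℕ) (hF : ∀ u v, u ∉ S → v ∉ S → Ad nb H u v → F u < F v)
    (w : Fin (2 ^ L)) (t : Fin P) (ht : t ∉ bc S w) (c : Fin P) :
    ∀ m : ℕ, ∀ c' : Fin P, (c' : ℕ) = c + m → F (core w t c) ≤ F (core w t c') := by
  intro m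
  induction m with
  | zero => intro c' h; rw [Fin.ext h]
  | succ m ih =>
    intro c' h
    have hc' := c'.2
    refine (ih ⟨c + m, by omega⟩ rfl).trans ?_
    exact (hF _ _ (core_alive S w t _ ht) (core_alive S w t _ ht)
      ⟨_, AdC.cc w t ⟨c + m, by omega⟩ c' (by simp only; omega)⟩).le

/-- label of a cell -/
noncomputable def fw (F : Vt L P → ℕ) (w : Fin (2 ^ L)) : ℕ :=
  sInf {m | ∃ t c : Fin P, t ∉ bc S w ∧ (c : ℕ) + 1 = P ∧ m = F (core w t c)}

lemma fw_mem (q : ℕ) (hqP : q < P) (F : Vt L P → ℕ) (w : Fin (2 ^ L)) (hw : del S w ≤ q) :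
    ∃ t c : Fin P, t ∉ bc S w ∧ (c : ℕ) + 1 = P ∧ fw S F w = F (core w t c) := by
  have : {m | ∃ t c : Fin P, t ∉ bc S w ∧ (c : ℕ) + 1 = P ∧ m = F (core w t c)}.Nonempty := by
    have h0 := s_le S w
    have h3 : (bc S w).card ≤ (s3 S w).card := card_image_le
    have : (bc S w).card < (univ : Finset (Fin P)).card := by
      rw [card_univ, Fintype.card_fin]; omega
    obtain ⟨t, _, ht⟩ := exists_mem_notMem_of_card_lt_card this
    exact ⟨_, t, ⟨P - 1, by omega⟩, ht, by simp only; omega, rfl⟩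
  exact Nat.sInf_mem this

lemma fw_le (F : Vt L P → ℕ) (w : Fin (2 ^ L)) (t c : Fin P) (ht : t ∉ bc S w) (hc : (c : ℕ) + 1 = P) :
    fw S F w ≤ F (core w t c) := Nat.sInf_le ⟨t, c, ht, hc, rfl⟩

lemma cell_mono (q : ℕ) (hqP : q < P) (F : Vt L P → ℕ)
    (hF : ∀ u v, u ∉ S → v ∉ S → Ad nb H u v → F u < F v)
    (x y : Fin (2 ^ L)) (hy : del S y ≤ q) (k : Fin L)
    (hxl : ¬ Lost H S x k) (hyl : ¬ Lost H S y k) (j : Fin 1024)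
    (hxy : ((x : ℕ) : ℤ) = nb k j ((y : ℕ) : ℤ)) : fw S F x < fw S F y := by
  unfold Lost at hxl hyl
  push Not at hxl hyl
  obtain ⟨_, _, i, hi⟩ := hxl
  obtain ⟨hp, ⟨i', hi'⟩, _⟩ := hyl
  obtain ⟨t, c, ht, hc, e⟩ := fw_mem S q hqP F y hy
  rw [e]
  have h1 := fw_le S F x (H i k) c hi hc
  have h2 := hF (core x (H i k) c) (port y k) (core_alive S x _ c hi) hp ⟨_, AdC.cp x y k _ c j i hxy rfl hc⟩
  have h3 := hF (port y k) (sup' y i' k) hp (sup_alive H S y i' k hi') ⟨_, AdC.ps y k i'⟩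
  have h4 := sup_core nb H S F hF y i' _ hi' t ht L k (by omega) rfl
  have h5 := core_core nb H S F hF y t ht (H i' k) (c - H i' k) c (by have := (H i' k).2; omega)
  omega

theorem graph_main (hnb : ∀ k j y, nb k j y / 2 ^ k = y / 2 ^ k - 1)
    (he1 : ∀ k, ExpF (EE nb k) k) (he2 : ∀ k, ExpF (fun x y => EE nb k (rv y) (rv x)) k)
    (q : ℕ) (hqP : q < P) (hH : ∀ B : Finset (Fin P), B.card ≤ q →
      ((univ : Finset (Fin L)).filter (fun k => ∀ i, H i k ∈ B)).card ≤ B.card)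
    (r d : ℕ) (h : ¬ ∃ p : List (Vt L P), PathIn (Ad nb H) p ∧ (∀ v ∈ p, v ∉ S) ∧ p.length = d + 1)
    (hS1 : 4 * ((13 * 2 ^ (r + 8) + 1) * S.card) ≤ (q + 1) * 2 ^ L)
    (hS2 : 4096 * S.card ≤ (r + 1) * 2 ^ L) :
    2 ^ L ≤ 8 * d * (2 * (L + 1)) ^ (2 * r) := by
  obtain ⟨F, hFd, hF⟩ := labels _ S d h
  set cst : Fin (2 ^ L) → ℤ := fun w => ((w : ℕ) : ℤ) with hcst
  have hinj : Function.Injective cst := by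
    intro a b hab
    apply Fin.ext
    simp only [hcst] at hab
    exact_mod_cast hab
  set Dd : Finset (Fin (2 ^ L)) := univ.filter (fun w => q < del S w) with hDd
  set Ls : ℕ → Finset (Fin (2 ^ L)) := fun k =>
    if hk : k < L then univ.filter (fun w => del S w ≤ q ∧ Lost H S w ⟨k, hk⟩) else ∅ with hLs
  have hsum : ∑ w, del S w = S.card := by
    unfold del
    exact (card_eq_sum_card_fiberwise (fun v _ => mem_univ _)).symm
  have hDcard : Dd.card * (q + 1) ≤ S.card := by
    rw [← hsum]
    calc Dd.card * (q + 1) = ∑ w ∈ Dd, (q + 1) := by simp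
      _ ≤ ∑ w ∈ Dd, del S w := sum_le_sum (fun w hw => (mem_filter.mp hw).2)
      _ ≤ _ := sum_le_sum_of_subset (subset_univ _)
  have hLcard : ∑ k ∈ range L, (Ls k).card ≤ S.card := by
    rw [← hsum, ← Fin.sum_univ_eq_sum_range (fun k => (Ls k).card)]
    have e : ∀ k : Fin L, (Ls k).card = ∑ w, (if del S w ≤ q ∧ Lost H S w k then 1 else 0) := by
      intro k
      rw [← card_filter]
      simp only [hLs, k.2, dif_pos]
    simp_rw [e]
    rw [sum_comm]
    apply sum_le_sum
    intro w _
    by_cases hw : del S w ≤ q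
    · have := lost_le H S q hH w hw
      rw [card_filter] at this
      simpa only [hw, true_and] using this
    · simp [hw]
  set f : ℤ → ℤ := fun x => if hx : 0 ≤ x ∧ x < 2 ^ L then
      (fw S F ⟨x.toNat, by
        have := hx.2
        zify; rw [Int.toNat_of_nonneg hx.1]; exact_mod_cast this⟩ : ℤ)
    else if x < 0 then x else d + 1 + x with hf
  have fin : ∀ x : Fin (2 ^ L), f (cst x) = fw S F x := by
    intro x
    have hx : (0 : ℤ) ≤ cst x ∧ cst x < 2 ^ L := by
      refine ⟨by simp [hcst], ?_⟩
      have := x.2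
      simp only [hcst]
      exact_mod_cast this
    simp only [hf]
    rw [dif_pos hx]
    congr 1
  have tofin : ∀ x : ℤ, 0 ≤ x → x < 2 ^ L → ∃ w, cst w = x := by
    intro x h0 h1
    refine ⟨⟨x.toNat, ?_⟩, ?_⟩
    · zify; rw [Int.toNat_of_nonneg h0]; exact_mod_cast h1
    · simp only [hcst]; exact Int.toNat_of_nonneg h0
  have fneg : ∀ x : ℤ, x < 0 → f x = x := by
    intro x hx
    simp only [hf]
    rw [dif_neg (by omega), if_pos hx]
  have fbig : ∀ x : ℤ, 2 ^ L ≤ x → f x = d + 1 + x := by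
    intro x hx
    have : (0 : ℤ) < 2 ^ L := by positivity
    simp only [hf]
    rw [dif_neg (by omega), if_neg (by omega)]
  have fd : ∀ w, del S w ≤ q → fw S F w < d := by
    intro w hw
    obtain ⟨t, c, ht, hc, e⟩ := fw_mem S q hqP F w hw
    rw [e]
    exact hFd _ (core_alive S w t c ht)
  have nD : ∀ w, cst w ∉ Dd.image cst → del S w ≤ q := by
    intro w hw
    by_contra hcon
    exact hw (mem_image_of_mem _ (mem_filter.mpr ⟨mem_univ _, by omega⟩))
  have hsys : Sys L (EE nb) f (Dd.image cst) (fun k => (Ls k).image cst) := by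
    refine ⟨fun k _ => he1 k, fun k _ => he2 k, ?_⟩
    intro k hk x y hx hy hE
    rw [mem_union, not_or] at hx hy
    obtain ⟨j, hj⟩ := hE
    have hlt : x < y := by rw [hj]; exact nb_lt nb hnb k j y
    have hpos : (0 : ℤ) < 2 ^ L := by positivity
    by_cases hx0 : x < 0
    · rw [fneg x hx0]
      by_cases hy0 : y < 0
      · rw [fneg y hy0]; exact hlt
      by_cases hy1 : y < 2 ^ L
      · obtain ⟨w, rfl⟩ := tofin y (by omega) hy1
        rw [fin]; omega
      · rw [fbig y (by omega)]; omega
    by_cases hx1 : x < 2 ^ L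
    · obtain ⟨w, rfl⟩ := tofin x (by omega) hx1
      have hwq := nD w hx.1
      rw [fin]
      by_cases hy1 : y < 2 ^ L
      · obtain ⟨w', rfl⟩ := tofin y (by omega) hy1
        have hwq' := nD w' hy.1
        rw [fin]
        have nl : ∀ w, del S w ≤ q → cst w ∉ (Ls k).image cst → ¬ Lost H S w ⟨k, hk⟩ := by
          intro w hw hn hl
          apply hn
          apply mem_image_of_mem
          simp only [hLs, hk, dif_pos]
          exact mem_filter.mpr ⟨mem_univ _, hw, hl⟩
        have := cell_mono nb H S q hqP F hF w w' hwq' ⟨k, hk⟩ (nl w hwq hx.2) (nl w' hwq' hy.2) j hj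
        exact_mod_cast this
      · rw [fbig y (by omega)]
        have := fd w hwq
        omega
    · rw [fbig x (by omega), fbig y (by omega)]; omega
  refine macro_main hsys r d ?_ ?_ ?_
  · intro x h0 h1 hxD
    obtain ⟨w, rfl⟩ := tofin x h0 h1
    rw [fin]
    have := fd w (nD w hxD)
    omega
  · have h1 : (Dd.image cst).card = Dd.card := card_image_of_injective _ hinj
    rw [h1]
    refine Nat.le_of_mul_le_mul_left ?_ (Nat.succ_pos q)
    rw [Nat.succ_eq_add_one]
    refine le_trans ?_ hS1
    calc (q + 1) * (4 * ((13 * 2 ^ (r + 8) + 1) * Dd.card))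
        = 4 * ((13 * 2 ^ (r + 8) + 1) * (Dd.card * (q + 1))) := by ring
      _ ≤ _ := by gcongr
  · have h1 : ∀ k ∈ range L, ((Ls k).image cst).card = (Ls k).card := fun k _ => card_image_of_injective _ hinj
    rw [sum_congr rfl h1]
    omega

end graph
end Grate

namespace Grate
open Finset Classical

lemma s_bound (s : ℕ) : s ≤ 8 * 2 ^ (s / 8) := by
  have : s / 8 < 2 ^ (s / 8) := Nat.lt_two_pow_self
  omega

lemma arith1 (s n L q : ℕ) (hs : 2 ^ s ≤ n) (hL : n ≤ 2 * L) (hq : L < (q + 1) ^ 4) :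
    2 ^ (s / 64) * s ≤ 16 * (q + 1) := by
  have h1 : (2 ^ (s / 64) * s) ^ 4 ≤ (16 * (q + 1)) ^ 4 := by
    calc (2 ^ (s / 64) * s) ^ 4 ≤ (2 ^ (s / 64) * (8 * 2 ^ (s / 8))) ^ 4 := by
          gcongr; exact s_bound s
      _ = 2 ^ 12 * 2 ^ (s / 64 * 4 + s / 8 * 4) := by
          rw [pow_add, pow_mul, pow_mul]; ring
      _ ≤ 2 ^ 12 * 2 ^ s := by
          gcongr
          · norm_num
          · omega
      _ ≤ 2 ^ 12 * n := by gcongr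
      _ ≤ 2 ^ 13 * (q + 1) ^ 4 := by omega
      _ ≤ _ := by rw [mul_pow]; exact Nat.mul_le_mul_right _ (by norm_num)
  exact (Nat.pow_le_pow_iff_left (by norm_num)).mp h1

lemma choose_lower (n s r : ℕ) (hs : 2 ^ s ≤ n) (hr : 1 ≤ r) (hrs : 64 * r ≤ s) :
    n ^ (5 * r) ≤ n.choose (16 * r) := by
  have h4 : 4 * s ^ 2 ≤ n := by
    calc 4 * s ^ 2 ≤ 4 * (8 * 2 ^ (s / 8)) ^ 2 := by gcongr; exact s_bound s
      _ = 2 ^ (8 + s / 8 * 2) := by rw [pow_add, pow_mul]; ring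
      _ ≤ 2 ^ s := by
        apply Nat.pow_le_pow_right (by norm_num); omega
      _ ≤ n := hs
  set m := Nat.sqrt n with hm
  have m1 : m * m ≤ n := Nat.sqrt_le n
  have m2 : n < (m + 1) * (m + 1) := Nat.lt_succ_sqrt n
  have m3 : 2 * s ≤ m := by rw [hm, Nat.le_sqrt]; nlinarith
  set j := 16 * r with hj
  have hjm : j * m ≤ n + 1 - j := by
    have : j * m + j ≤ m * m := by nlinarith
    omega
  have h5 : (n + 1 - j) ^ j ≤ j.factorial * n.choose j := by
    have h := Nat.pow_le_choose (α := ℝ) j n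
    rw [div_le_iff₀ (by positivity), mul_comm] at h
    exact_mod_cast h
  have h6 : (j * m) ^ j ≤ j ^ j * n.choose j := by
    calc (j * m) ^ j ≤ (n + 1 - j) ^ j := Nat.pow_le_pow_left hjm j
      _ ≤ j.factorial * n.choose j := h5
      _ ≤ _ := Nat.mul_le_mul_right _ (Nat.factorial_le_pow j)
  rw [mul_pow] at h6
  have h7 : m ^ j ≤ n.choose j := Nat.le_of_mul_le_mul_left h6 (by positivity)
  refine le_trans ?_ h7
  have h8 : n ≤ m ^ 3 := by
    have : 3 ≤ m := by omega
    nlinarith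
  calc n ^ (5 * r) ≤ (m ^ 3) ^ (5 * r) := Nat.pow_le_pow_left h8 _
    _ = m ^ (15 * r) := by rw [← pow_mul]; congr 1; ring
    _ ≤ m ^ j := Nat.pow_le_pow_right (by omega) (by omega)

lemma arith2 (n s : ℕ) (hs1 : 1 ≤ s) (hs : 2 ^ s ≤ n)
    (h : 2 ^ 17 * ∑ j ∈ range (s + 1), n.choose j ≤ 8 * n * (2 * n) ^ (2 * (s / 64))) : False := by
  have hn : 2 ≤ n := le_trans (by calc 2 = 2 ^ 1 := by norm_num
                                    _ ≤ 2 ^ s := Nat.pow_le_pow_right (by norm_num) hs1) hs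
  rcases Nat.eq_zero_or_pos (s / 64) with h0 | h0
  · rw [h0] at h
    have : n.choose 1 ≤ ∑ j ∈ range (s + 1), n.choose j :=
      single_le_sum (f := fun j => n.choose j) (fun _ _ => Nat.zero_le _) (mem_range.mpr (by omega))
    rw [Nat.choose_one_right] at this
    simp only [mul_zero, pow_zero, mul_one] at h
    omega
  · have hc := choose_lower n s (s / 64) hs h0 (by omega)
    have : n.choose (16 * (s / 64)) ≤ ∑ j ∈ range (s + 1), n.choose j :=
      single_le_sum (f := fun j => n.choose j) (fun _ _ => Nat.zero_le _) (mem_range.mpr (by omega))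
    set r := s / 64 with hr
    have h2 : 8 * n * (2 * n) ^ (2 * r) ≤ 8 * n ^ (5 * r) := by
      calc 8 * n * (2 * n) ^ (2 * r) ≤ 8 * n * (n * n) ^ (2 * r) := by gcongr
        _ = 8 * n ^ (4 * r + 1) := by
          rw [← pow_two, ← pow_mul, pow_succ]; rw [show 2 * (2 * r) = 4 * r by ring]; ring
        _ ≤ _ := Nat.mul_le_mul_left _ (Nat.pow_le_pow_right (by omega) (by omega))
    have h3 : 0 < n ^ (5 * r) := by positivity
    generalize n ^ (5 * r) = T at *
    omega

theorem large : ∃ n0 : ℕ, ∀ n, n0 ≤ n → ∃ G : Dig, Acyclic G.Adj ∧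
    Nat.card G.V ≤ 20 * 2 ^ 17 * 2 ^ n ∧ (∀ x : G.V, indeg G.Adj x ≤ 8192) ∧
    ∀ s : ℕ, 1 ≤ s → 2 ^ s ≤ n →
      DepthRobust G.Adj (s * 2 ^ n / (2 * n)) (2 ^ n / ∑ j ∈ Finset.range (s + 1), n.choose j) := by
  refine ⟨2 ^ 18, ?_⟩
  intro n hn
  have hex : ∃ L, 2 ^ 17 * 2 ^ n ≤ n * 2 ^ L := ⟨n, Nat.mul_le_mul_right _ (by omega)⟩
  obtain ⟨L, hL1, hL2, hLn⟩ : ∃ L, 2 ^ 17 * 2 ^ n ≤ n * 2 ^ L ∧ n * 2 ^ L ≤ 2 * (2 ^ 17 * 2 ^ n) ∧ L + 1 ≤ n := by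
    refine ⟨Nat.find hex, Nat.find_spec hex, ?_, ?_⟩
    · rcases Nat.eq_zero_or_pos (Nat.find hex) with h | h
      · rw [h]
        have : n < 2 ^ n := Nat.lt_two_pow_self
        omega
      · have := Nat.find_min hex (Nat.sub_lt h Nat.one_pos)
        have e : 2 ^ (Nat.find hex) = 2 ^ (Nat.find hex - 1) * 2 := by
          rw [← pow_succ]; congr 1; omega
        rw [e, ← mul_assoc]
        omega
    · have : Nat.find hex ≤ n - 1 := by
        apply Nat.find_min'
        have e : 2 ^ n = 2 ^ (n - 1) * 2 := by
          rw [← pow_succ]; congr 1; omega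
        rw [e]
        calc 2 ^ 17 * (2 ^ (n - 1) * 2) = 2 ^ 18 * 2 ^ (n - 1) := by ring
          _ ≤ _ := Nat.mul_le_mul_right _ hn
      omega
  have hL3 : n ≤ 2 * L := by
    have e : 2 ^ n = 2 ^ (n - L) * 2 ^ L := by rw [← pow_add]; congr 1; omega
    rw [e, ← mul_assoc] at hL1
    have h1 := Nat.le_of_mul_le_mul_right hL1 (by positivity)
    have : n - L < 2 ^ (n - L) := Nat.lt_two_pow_self
    omega
  obtain ⟨q, hq1, hq2⟩ : ∃ q, q ^ 4 ≤ L ∧ L < (q + 1) ^ 4 := by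
    refine ⟨Nat.sqrt (Nat.sqrt L), ?_, ?_⟩
    · have h1 := Nat.sqrt_le' (Nat.sqrt L)
      have h2 := Nat.sqrt_le' L
      calc (Nat.sqrt (Nat.sqrt L)) ^ 4 = ((Nat.sqrt (Nat.sqrt L)) ^ 2) ^ 2 := by ring
        _ ≤ (Nat.sqrt L) ^ 2 := Nat.pow_le_pow_left h1 2
        _ ≤ L := h2
    · have h1 := Nat.lt_succ_sqrt' (Nat.sqrt L)
      have h2 := Nat.lt_succ_sqrt' L
      calc L < (Nat.sqrt L + 1) ^ 2 := h2
        _ ≤ ((Nat.sqrt (Nat.sqrt L) + 1) ^ 2) ^ 2 := Nat.pow_le_pow_left h1 2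
        _ = _ := by ring
  have hq : 16 ≤ q := by
    by_contra hcon
    have : (q + 1) ^ 4 ≤ 16 ^ 4 := Nat.pow_le_pow_left (by omega) 4
    omega
  obtain ⟨H, hH⟩ := design L q hq hq2
  obtain ⟨nb, hnb, he1, he2⟩ := inb_exists
  refine ⟨⟨Vt L (q ^ 2), Ad nb H⟩, acyclic_of_rk _ rk (Ad_rk nb H hnb), ?_, Ad_indeg nb H, ?_⟩
  · show Nat.card (Vt L (q ^ 2)) ≤ _
    rw [card_Vt]
    have : q ^ 2 * q ^ 2 = q ^ 4 := by ring
    rw [this]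
    calc 2 ^ L * (9 * L + q ^ 4) ≤ 2 ^ L * (10 * n) := Nat.mul_le_mul_left _ (by omega)
      _ = 10 * (n * 2 ^ L) := by ring
      _ ≤ 10 * (2 * (2 ^ 17 * 2 ^ n)) := Nat.mul_le_mul_left _ hL2
      _ = _ := by ring
  · intro s hs1 hs S hS
    by_contra hcon
    have hn0 : 0 < n := by omega
    have hS' : 2 ^ 18 * S.card ≤ s * 2 ^ L := by
      rw [Nat.le_div_iff_mul_le (by omega)] at hS
      refine Nat.le_of_mul_le_mul_left ?_ hn0
      calc n * (2 ^ 18 * S.card) = 2 ^ 17 * (S.card * (2 * n)) := by ring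
        _ ≤ 2 ^ 17 * (s * 2 ^ n) := Nat.mul_le_mul_left _ hS
        _ = s * (2 ^ 17 * 2 ^ n) := by ring
        _ ≤ s * (n * 2 ^ L) := Nat.mul_le_mul_left _ hL1
        _ = _ := by ring
    have hmain := graph_main nb H S hnb he1 he2 q (by nlinarith) hH (s / 64)
      (2 ^ n / ∑ j ∈ Finset.range (s + 1), n.choose j) hcon ?_ ?_
    · apply arith2 n s hs1 hs
      set sg := ∑ j ∈ Finset.range (s + 1), n.choose j with hsg
      set d := 2 ^ n / sg with hd
      have hdd : d * sg ≤ 2 ^ n := Nat.div_mul_le_self _ _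
      refine Nat.le_of_mul_le_mul_right ?_ (show 0 < 2 ^ n by positivity)
      calc 2 ^ 17 * sg * 2 ^ n = (2 ^ 17 * 2 ^ n) * sg := by ring
        _ ≤ (n * 2 ^ L) * sg := Nat.mul_le_mul_right _ hL1
        _ ≤ (n * (8 * d * (2 * (L + 1)) ^ (2 * (s / 64)))) * sg := by gcongr
        _ ≤ (n * (8 * d * (2 * n) ^ (2 * (s / 64)))) * sg := by gcongr
        _ = 8 * n * (2 * n) ^ (2 * (s / 64)) * (d * sg) := by ring
        _ ≤ _ := Nat.mul_le_mul_left _ hdd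
    · have ha := arith1 s n L q hs hL3 hq2
      have h1 : 13 * 2 ^ (s / 64 + 8) + 1 ≤ 2 ^ (s / 64) * 2 ^ 12 := by
        rw [pow_add]
        have : 1 ≤ 2 ^ (s / 64) := Nat.one_le_two_pow
        omega
      refine Nat.le_of_mul_le_mul_left ?_ (show 0 < 16 by norm_num)
      calc 16 * (4 * ((13 * 2 ^ (s / 64 + 8) + 1) * S.card))
          ≤ 16 * (4 * ((2 ^ (s / 64) * 2 ^ 12) * S.card)) := by gcongr
        _ = 2 ^ (s / 64) * (2 ^ 18 * S.card) := by ring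
        _ ≤ 2 ^ (s / 64) * (s * 2 ^ L) := Nat.mul_le_mul_left _ hS'
        _ = (2 ^ (s / 64) * s) * 2 ^ L := by ring
        _ ≤ (16 * (q + 1)) * 2 ^ L := Nat.mul_le_mul_right _ ha
        _ = _ := by ring
    · refine Nat.le_of_mul_le_mul_left ?_ (show 0 < 64 by norm_num)
      calc 64 * (4096 * S.card) = 2 ^ 18 * S.card := by ring
        _ ≤ s * 2 ^ L := hS'
        _ ≤ (64 * (s / 64 + 1)) * 2 ^ L := Nat.mul_le_mul_right _ (by omega)
        _ = _ := by ring

theorem small (n : ℕ) (hn : 1 ≤ n) : ∃ G : Dig, Acyclic G.Adj ∧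
    Nat.card G.V ≤ 2 * 2 ^ n + 1 ∧ (∀ x : G.V, indeg G.Adj x ≤ 2 * 2 ^ n + 1) ∧
    ∀ s : ℕ, 1 ≤ s → 2 ^ s ≤ n →
      DepthRobust G.Adj (s * 2 ^ n / (2 * n)) (2 ^ n / ∑ j ∈ Finset.range (s + 1), n.choose j) := by
  refine ⟨⟨Fin (2 * 2 ^ n + 1), fun a b => a < b⟩, ?_, ?_, ?_, ?_⟩
  · exact acyclic_of_rk _ (fun a => (a : ℕ)) (fun a b h => h)
  · show Nat.card (Fin (2 * 2 ^ n + 1)) ≤ _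
    simp
  · intro x
    show Nat.card {u : Fin (2 * 2 ^ n + 1) // u < x} ≤ _
    refine (Nat.card_le_card_of_injective (fun u : {u : Fin (2 * 2 ^ n + 1) // u < x} => u.1) Subtype.val_injective).trans ?_
    simp
  · intro s hs1 hs S hS
    change Finset (Fin (2 * 2 ^ n + 1)) at S
    set d := 2 ^ n / ∑ j ∈ Finset.range (s + 1), n.choose j with hd
    have hd1 : d ≤ 2 ^ n := Nat.div_le_self _ _
    have hsn : s ≤ n := Nat.lt_two_pow_self.le.trans hs
    have hS1 : S.card ≤ 2 ^ n := by
      refine hS.trans ?_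
      apply Nat.div_le_of_le_mul
      apply Nat.mul_le_mul_right; omega
    have hc : d + 1 ≤ (univ \ S).card := by
      rw [card_sdiff_of_subset (subset_univ _), card_univ, Fintype.card_fin]; omega
    obtain ⟨T, hT1, hT2⟩ := exists_subset_card_eq hc
    refine ⟨T.sort (· ≤ ·), ⟨?_, ?_⟩, ?_, ?_⟩
    · intro h
      have := congrArg List.length h
      rw [length_sort, hT2] at this
      simp at this
    · exact (Finset.sortedLT_sort T).pairwise.isChain
    · intro v hv
      have := hT1 ((mem_sort _).mp hv)
      exact (mem_sdiff.mp this).2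
    · rw [length_sort]; exact hT2

end Grate

/-- There are a constant `c > 0` and a family of
constant-indegree DAGs `{G_n}` such that `G_n` has at most `c·2^n` nodes and,
for every `s` with `1 ≤ s ≤ log₂ n`, `G_n` is
`(s·2^n/(2n), 2^n / Σ_{j=0}^{s} (n choose j))`-depth-robust. -/
theorem exists_grates_node_depth_robust_family :
    ∃ (c : ℝ) (cind : ℕ), 0 < c ∧
      ∃ G : ℕ → Dig, ∀ n, 1 ≤ n →
        Acyclic (G n).Adj ∧
        ((Nat.card (G n).V : ℝ) ≤ c * 2 ^ n) ∧
        (∀ x : (G n).V, indeg (G n).Adj x ≤ cind) ∧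
        ∀ s : ℕ, 1 ≤ s → (s : ℝ) ≤ Real.logb 2 n →
          DepthRobust (G n).Adj (s * 2 ^ n / (2 * n))
            (2 ^ n / ∑ j ∈ Finset.range (s + 1), n.choose j) := by
  obtain ⟨n0, hlarge⟩ := Grate.large
  have key : ∀ n : ℕ, ∃ G : Dig, 1 ≤ n → (Acyclic G.Adj ∧
      Nat.card G.V ≤ 20 * 2 ^ 17 * 2 ^ n ∧ (∀ x : G.V, indeg G.Adj x ≤ 2 * 2 ^ n0 + 1 + 8192) ∧
      ∀ s : ℕ, 1 ≤ s → 2 ^ s ≤ n →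
        DepthRobust G.Adj (s * 2 ^ n / (2 * n)) (2 ^ n / ∑ j ∈ Finset.range (s + 1), n.choose j)) := by
    intro n
    by_cases h1 : 1 ≤ n
    · by_cases h : n0 ≤ n
      · obtain ⟨G, a, b, c, d⟩ := hlarge n h
        exact ⟨G, fun _ => ⟨a, b, fun x => (c x).trans (by omega), d⟩⟩
      · obtain ⟨G, a, b, c, d⟩ := Grate.small n h1
        refine ⟨G, fun _ => ⟨a, b.trans ?_, fun x => (c x).trans ?_, d⟩⟩
        · have : 1 ≤ 2 ^ n := Nat.one_le_two_pow
          omega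
        · have : 2 ^ n ≤ 2 ^ n0 := Nat.pow_le_pow_right (by norm_num) (by omega)
          omega
    · exact ⟨⟨Fin 1, fun _ _ => False⟩, fun h => absurd h h1⟩
  choose G hG using key
  refine ⟨20 * 2 ^ 17, 2 * 2 ^ n0 + 1 + 8192, by norm_num, G, ?_⟩
  intro n hn
  obtain ⟨a, b, c, d⟩ := hG n hn
  refine ⟨a, ?_, c, ?_⟩
  · exact_mod_cast b
  · intro s hs1 hs
    refine d s hs1 ?_
    have hn' : (0 : ℝ) < n := by exact_mod_cast hn
    rw [Real.le_logb_iff_rpow_le (by norm_num) hn', Real.rpow_natCast] at hs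
    exact_mod_cast hs
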